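/- arXiv:math/0311435 — 4 statements merged into one kernel-verified Lean document; each statement's English description precedes it below -/
import Mathlib

section
/- For every prime p and every natural number k ≥ 1, there exists a bijection from the disjoint union ({0} × R^{(k)}) ∪ ({1} × R^{(k)}) (a subset of ℚ_p²) onto R^{(k)} (a subset of ℚ_p) whose graph, viewed as a subset of ℚ_p³ (encoded as Set (Fin 3 → ℚ_p)), is ∅-definable in the first-order language of rings. -/
open FirstOrder

noncomputable instance (p : ℕ) [Fact p.Prime] : FirstOrder.Ring.CompatibleRing ℚ_[p] :=
  FirstOrder.Ring.compatibleRingOfRing _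

/-- `R^{(k)}` viewed as a subset of `ℚ_p`: the nonzero elements of the valuation ring
whose angular component is congruent to `1` modulo `p^k`. -/
def angOneQ (p : ℕ) [Fact p.Prime] (k : ℕ) : Set ℚ_[p] :=
  {x | ‖x‖ ≤ 1 ∧ ∃ m : ℕ, ‖x - (p : ℚ_[p]) ^ m‖ ≤ (p : ℝ) ^ (-(m + k : ℤ))}

namespace FirstOrder.Ring

variable {R α : Type*} [CommRing R] [CompatibleRing R]

theorem definable_freeCommRing_lift_eq (q q' : FreeCommRing α) :
    (∅ : Set R).Definable Language.ring
      {v : α → R | FreeCommRing.lift v q = FreeCommRing.lift v q'} := by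
  simp only [← realize_termOfFreeCommRing]
  exact (Language.Term.definableFun_realize _).ofPred_eq (Language.Term.definableFun_realize _)

end FirstOrder.Ring

theorem Set.Definable.exists_snoc {L : Language} {M : Type*} [L.Structure M] {A : Set M} {n : ℕ}
    {P : (Fin n → M) → M → Prop}
    (h : A.Definable L {w : Fin (n + 1) → M | P (fun i => w i.castSucc) (w (Fin.last n))}) :
    A.Definable L {v : Fin n → M | ∃ y, P v y} := by
  convert! h.image_comp Fin.castSucc using 1
  ext v
  constructor
  · rintro ⟨y, hy⟩
    exact ⟨Fin.snoc v y, by simpa using hy, by ext; simp⟩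
  · rintro ⟨w, hw, rfl⟩
    exact ⟨_, hw⟩

theorem Set.Definable₁.preimage_proj {L : Language} {M : Type*} [L.Structure M] {A D : Set M}
    (hD : A.Definable₁ L D) {α : Type*} (i : α) : A.Definable L {v : α → M | v i ∈ D} :=
  hD.preimage_comp fun _ : Fin 1 => i

section PadicInt

variable {p : ℕ} [hp : Fact p.Prime]

open Polynomial in
/-- Hensel's lemma for `n`-th roots of elements close to `1`. -/
theorem PadicInt.exists_pow_eq_of_norm_lt {n : ℕ} {w : ℤ_[p]}
    (hw : ‖w - 1‖ < ‖(n : ℤ_[p])‖ ^ 2) :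
    ∃ z : ℤ_[p], z ^ n = w ∧ ‖z - 1‖ < ‖(n : ℤ_[p])‖ ∧
      ∀ z' : ℤ_[p], z' ^ n = w → ‖z' - 1‖ < ‖(n : ℤ_[p])‖ → z' = z := by
  have h1 : ‖(X ^ n - C w : ℤ_[p][X]).aeval (1 : ℤ_[p])‖ <
      ‖(X ^ n - C w : ℤ_[p][X]).derivative.aeval (1 : ℤ_[p])‖ ^ 2 := by
    simpa [norm_sub_rev, derivative_X_pow] using hw
  obtain ⟨z, hz, hz1, -, hz'⟩ := hensels_lemma h1
  refine ⟨z, by simpa [sub_eq_zero] using hz, by simpa [derivative_X_pow] using hz1,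
    fun z' h h' => hz' z' ?_ ?_⟩
  · simp [h]
  · simpa [derivative_X_pow] using h'

theorem PadicInt.norm_le_pow_iff_dvd (x : ℤ_[p]) (n : ℕ) :
    ‖x‖ ≤ (p : ℝ) ^ (-n : ℤ) ↔ (p : ℤ_[p]) ^ n ∣ x := by
  rw [norm_le_pow_iff_mem_span_pow, Ideal.mem_span_singleton]

theorem Padic.norm_le_one_iff_exists_pow_eq (x : ℚ_[p]) :
    ‖x‖ ≤ 1 ↔ ∃ y : ℚ_[p], y ^ (p + 1) = 1 + p * x ^ (p + 1) := by
  constructor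
  · intro hx
    obtain ⟨x, rfl⟩ : ∃ x' : ℤ_[p], (x' : ℚ_[p]) = x := ⟨⟨x, hx⟩, rfl⟩
    have hn : ‖((p + 1 : ℕ) : ℤ_[p])‖ = 1 := by
      rw [PadicInt.norm_natCast_eq_one_iff]; simp
    obtain ⟨z, hz, -⟩ := PadicInt.exists_pow_eq_of_norm_lt (n := p + 1)
      (w := 1 + (p : ℤ_[p]) * x ^ (p + 1)) (by
        rw [hn, add_sub_cancel_left, one_pow, PadicInt.norm_lt_one_iff_dvd]
        exact dvd_mul_right _ _)
    exact ⟨z, by exact_mod_cast congrArg ((↑) : ℤ_[p] → ℚ_[p]) hz⟩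
  · rintro ⟨y, hy⟩
    by_contra! hx
    have hx0 : x ≠ 0 := by rintro rfl; simp at hx; linarith
    have hp1 : (1 : ℝ) < p := mod_cast hp.out.one_lt
    have hp0 : (p : ℚ_[p]) ≠ 0 := mod_cast hp.out.ne_zero
    have hv : x.valuation < 0 := by
      rw [Padic.norm_eq_zpow_neg_valuation hx0] at hx
      have := (one_lt_zpow_iff_right₀ hp1).1 hx
      omega
    have hlt : (1 : ℝ) < ‖(p : ℚ_[p]) * x ^ (p + 1)‖ := by
      rw [norm_mul, norm_pow, Padic.norm_eq_zpow_neg_valuation hx0, Padic.norm_p,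
        ← zpow_natCast, ← zpow_mul, ← zpow_neg_one, ← zpow_add₀ (by positivity)]
      refine one_lt_zpow₀ hp1 ?_
      have : (1 : ℤ) < p := mod_cast hp.out.one_lt
      push_cast
      nlinarith
    have hnorm : ‖y ^ (p + 1)‖ = ‖(p : ℚ_[p]) * x ^ (p + 1)‖ := by
      rw [hy, Padic.add_eq_max_of_ne (by rw [norm_one]; exact hlt.ne), norm_one,
        max_eq_right hlt.le]
    have hy0 : y ≠ 0 := by
      rintro rfl
      rw [zero_pow p.succ_ne_zero, norm_zero] at hnorm
      linarith
    rw [norm_mul, norm_pow, norm_pow, Padic.norm_eq_zpow_neg_valuation hx0,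
      Padic.norm_eq_zpow_neg_valuation hy0, Padic.norm_p, ← zpow_natCast, ← zpow_mul,
      ← zpow_natCast, ← zpow_mul, ← zpow_neg_one, ← zpow_add₀ (by positivity)] at hnorm
    have hz := zpow_right_injective₀ (by positivity) hp1.ne' hnorm
    have hd : ((p + 1 : ℕ) : ℤ) ∣ 1 :=
      ⟨y.valuation - x.valuation, by linear_combination hz⟩
    have := Int.le_of_dvd one_pos hd
    have := hp.out.pos
    omega

theorem Padic.definable₁_closedBall :
    (∅ : Set ℚ_[p]).Definable₁ Language.ring {x | ‖x‖ ≤ 1} := by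
  unfold Set.Definable₁
  simp only [Set.mem_ofPred_eq, Padic.norm_le_one_iff_exists_pow_eq]
  refine Set.Definable.exists_snoc ?_
  convert! FirstOrder.Ring.definable_freeCommRing_lift_eq (R := ℚ_[p])
    (FreeCommRing.of (1 : Fin 2) ^ (p + 1)) (1 + p * FreeCommRing.of (0 : Fin 2) ^ (p + 1)) using 2
  simp

theorem mem_angOneQ_iff {k : ℕ} {x : ℚ_[p]} :
    x ∈ angOneQ p k ↔
      ∃ (m : ℕ) (u : ℤ_[p]), (p : ℤ_[p]) ^ k ∣ u - 1 ∧ x = (p : ℚ_[p]) ^ m * u := by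
  have hp0 : (p : ℚ_[p]) ≠ 0 := mod_cast hp.out.ne_zero
  have hpr : (p : ℝ) ≠ 0 := mod_cast hp.out.ne_zero
  constructor
  · rintro ⟨-, m, hm⟩
    have key : ‖x / (p : ℚ_[p]) ^ m - 1‖ ≤ (p : ℝ) ^ (-k : ℤ) := by
      rw [div_sub_one (pow_ne_zero _ hp0), norm_div, norm_pow, Padic.norm_p, div_le_iff₀
        (by have := hp.out.pos; positivity)]
      refine hm.trans_eq ?_
      rw [neg_add_rev, zpow_add₀ hpr, zpow_neg _ (m : ℤ), zpow_natCast, inv_pow]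
    have h1 : ‖x / (p : ℚ_[p]) ^ m‖ ≤ 1 := by
      have h2 : ‖x / (p : ℚ_[p]) ^ m - 1‖ ≤ 1 :=
        key.trans (zpow_le_one_of_nonpos₀ (mod_cast hp.out.one_lt.le) (by simp))
      have := Padic.nonarchimedean (x / (p : ℚ_[p]) ^ m - 1) 1
      simp only [sub_add_cancel, norm_one] at this
      exact this.trans (max_le h2 le_rfl)
    refine ⟨m, ⟨_, h1⟩, ?_, ?_⟩
    · rw [← PadicInt.norm_le_pow_iff_dvd]
      exact key
    · simp only
      field_simp
  · rintro ⟨m, u, hu, rfl⟩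
    constructor
    · exact (((p : ℤ_[p]) ^ m * u).2 : _)
    · refine ⟨m, ?_⟩
      rw [← PadicInt.norm_le_pow_iff_dvd] at hu
      have : (p : ℚ_[p]) ^ m * u - (p : ℚ_[p]) ^ m =
          (p : ℚ_[p]) ^ m * ((u - 1 : ℤ_[p]) : ℚ_[p]) := by
        push_cast; ring
      rw [this, norm_mul, norm_pow, Padic.norm_p, neg_add, zpow_add₀ hpr, zpow_neg _ (m : ℤ),
        zpow_natCast, inv_pow]
      gcongr
      exact hu

theorem PadicInt.norm_eq_one_of_dvd_sub_one {k : ℕ} (hk : 1 ≤ k) {u : ℤ_[p]}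
    (hu : (p : ℤ_[p]) ^ k ∣ u - 1) : ‖u‖ = 1 := by
  by_contra h
  have h1 : (p : ℤ_[p]) ∣ u :=
    (norm_lt_one_iff_dvd u).1 (lt_of_le_of_ne (norm_le_one u) h)
  have h2 := (dvd_sub_right h1).1 ((dvd_pow_self _ (by omega)).trans hu)
  exact prime_p.not_dvd_one h2

theorem PadicInt.pow_mul_inj {m m' : ℕ} {u u' : ℤ_[p]} (hu : ‖u‖ = 1) (hu' : ‖u'‖ = 1)
    (h : (p : ℚ_[p]) ^ m * u = (p : ℚ_[p]) ^ m' * u') : m = m' ∧ u = u' := by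
  have hp0 : (p : ℚ_[p]) ≠ 0 := mod_cast hp.out.ne_zero
  have hm : m = m' := by
    have := congrArg norm h
    simp only [norm_mul, norm_pow, Padic.norm_p, PadicInt.padic_norm_e_of_padicInt, hu, hu',
      mul_one, inv_pow, inv_inj] at this
    exact Nat.pow_right_injective hp.out.two_le (by exact_mod_cast this)
  subst hm
  exact ⟨rfl, PadicInt.ext (mul_left_cancel₀ (pow_ne_zero m hp0) h)⟩

theorem PadicInt.pow_dvd_pow_totient_sub_one (k : ℕ) {u : ℤ_[p]} (hu : ‖u‖ = 1) :
    (p : ℤ_[p]) ^ k ∣ u ^ (p ^ k).totient - 1 := by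
  rw [← Ideal.mem_span_singleton, ← PadicInt.ker_toZModPow, RingHom.mem_ker, map_sub, map_pow,
    map_one, sub_eq_zero]
  obtain ⟨v, hv⟩ := (PadicInt.isUnit_iff.2 hu).map (PadicInt.toZModPow (p := p) k)
  rw [← hv, ← Units.val_pow_eq_pow_val, ZMod.pow_totient, Units.val_one]

theorem mem_angOneQ_iff_exists {k : ℕ} {x : ℚ_[p]} :
    x ∈ angOneQ p k ↔
      ∃ (j : Fin (p ^ k).totient) (y z : ℚ_[p]), y ≠ 0 ∧ ‖y‖ ≤ 1 ∧ ‖z‖ ≤ 1 ∧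
        x = (p : ℚ_[p]) ^ (j : ℕ) * y ^ (p ^ k).totient * (1 + (p : ℚ_[p]) ^ k * z) := by
  have hp0 : (p : ℚ_[p]) ≠ 0 := mod_cast hp.out.ne_zero
  have hn : 0 < (p ^ k).totient := Nat.totient_pos.2 (pow_pos hp.out.pos _)
  rw [mem_angOneQ_iff]
  set n := (p ^ k).totient with hn_def
  constructor
  · rintro ⟨m, u, ⟨z, hz⟩, rfl⟩
    refine ⟨⟨m % n, Nat.mod_lt _ hn⟩, (p : ℚ_[p]) ^ (m / n), z, pow_ne_zero _ hp0,
      ((p : ℤ_[p]) ^ (m / n)).2, z.2, ?_⟩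
    have h1 : (u : ℚ_[p]) = 1 + (p : ℚ_[p]) ^ k * z := by
      have := congrArg ((↑) : ℤ_[p] → ℚ_[p]) hz
      push_cast at this
      linear_combination this
    rw [h1, ← pow_mul, ← pow_add, mul_comm (m / n), Nat.mod_add_div]
  · rintro ⟨j, y, z, hy0, hy, hz, rfl⟩
    obtain ⟨y, rfl⟩ : ∃ y' : ℤ_[p], (y' : ℚ_[p]) = y := ⟨⟨y, hy⟩, rfl⟩
    obtain ⟨z, rfl⟩ : ∃ z' : ℤ_[p], (z' : ℚ_[p]) = z := ⟨⟨z, hz⟩, rfl⟩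
    have hy0' : y ≠ 0 := by rintro rfl; simp at hy0
    have hu := PadicInt.unitCoeff_spec hy0'
    set v := PadicInt.unitCoeff hy0'
    refine ⟨j + y.valuation * n, (v : ℤ_[p]) ^ n * (1 + p ^ k * z), ?_, ?_⟩
    · have h := PadicInt.pow_dvd_pow_totient_sub_one k (PadicInt.norm_units v)
      have : (v : ℤ_[p]) ^ n * (1 + p ^ k * z) - 1 =
        ((v : ℤ_[p]) ^ n - 1) + p ^ k * ((v : ℤ_[p]) ^ n * z) := by ring
      rw [this]
      exact dvd_add h (dvd_mul_right _ _)
    · conv_lhs => rw [hu]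
      push_cast
      ring

theorem definable₁_angOneQ (k : ℕ) :
    (∅ : Set ℚ_[p]).Definable₁ Language.ring (angOneQ p k) := by
  unfold Set.Definable₁
  simp only [mem_angOneQ_iff_exists]
  rw [Set.ofPred_exists]
  refine Set.definable_iUnion_of_finite fun j => ?_
  refine Set.Definable.exists_snoc (Set.Definable.exists_snoc ?_)
  refine .inter (.compl ?_) (.inter ?_ (.inter ?_ ?_))
  · convert! FirstOrder.Ring.definable_freeCommRing_lift_eq (R := ℚ_[p])
      (FreeCommRing.of (1 : Fin 3)) 0 using 2
    simp
    rfl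
  · exact Padic.definable₁_closedBall.preimage_proj (1 : Fin 3)
  · exact Padic.definable₁_closedBall.preimage_proj (2 : Fin 3)
  · convert! FirstOrder.Ring.definable_freeCommRing_lift_eq (R := ℚ_[p])
      (FreeCommRing.of (0 : Fin 3)) (p ^ (j : ℕ) * FreeCommRing.of (1 : Fin 3) ^ (p ^ k).totient *
        (1 + p ^ k * FreeCommRing.of (2 : Fin 3))) using 2
    simp
    rfl

end PadicInt

section MonomialTiling

variable {K : Type*} [CommRing K] {ι κ : Type*} {A D E : Set K}

/-- `A` is the disjoint union, indexed by `ι`, of bijective images of `D` under monomials with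
natural number coefficients. -/
def IsMonomialTiling (ι : Type*) (D A : Set K) : Prop :=
  ∃ a n : ι → ℕ,
    Set.BijOn (fun q : ι × K => (a q.1 : K) * q.2 ^ n q.1) (Set.univ ×ˢ D) A

theorem IsMonomialTiling.refl (D : Set K) : IsMonomialTiling Unit D D := by
  refine ⟨fun _ => 1, fun _ => 1, ?_, ?_, ?_⟩
  · rintro ⟨i, y⟩ ⟨-, hy⟩
    simpa using hy
  · rintro ⟨i, y⟩ - ⟨i', y'⟩ - h
    simpa using h
  · intro y hy
    exact ⟨((), y), ⟨trivial, hy⟩, by simp⟩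

theorem IsMonomialTiling.trans (h : IsMonomialTiling ι D E) (h' : IsMonomialTiling κ E A) :
    IsMonomialTiling (κ × ι) D A := by
  obtain ⟨a, n, hm, hi, hs⟩ := h
  obtain ⟨b, m, hm', hi', hs'⟩ := h'
  refine ⟨fun q => b q.1 * a q.2 ^ m q.1, fun q => n q.2 * m q.1, ?_⟩
  have key : (fun q : (κ × ι) × K =>
      ((b q.1.1 * a q.1.2 ^ m q.1.1 : ℕ) : K) * q.2 ^ (n q.1.2 * m q.1.1)) =
      fun q : (κ × ι) × K => (b q.1.1 : K) * (a q.1.2 * q.2 ^ n q.1.2) ^ m q.1.1 := by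
    ext q
    push_cast
    ring
  rw [key]
  refine ⟨?_, ?_, ?_⟩
  · rintro ⟨⟨j, i⟩, y⟩ ⟨-, hy⟩
    exact hm' (x := (j, _)) ⟨trivial, hm (x := (i, y)) ⟨trivial, hy⟩⟩
  · rintro ⟨⟨j, i⟩, y⟩ ⟨-, hy⟩ ⟨⟨j', i'⟩, y'⟩ ⟨-, hy'⟩ h
    have h1 := hi' (x₁ := (j, _)) (x₂ := (j', _)) ⟨trivial, hm (x := (i, y)) ⟨trivial, hy⟩⟩
      ⟨trivial, hm (x := (i', y')) ⟨trivial, hy'⟩⟩ h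
    have h2 := hi (x₁ := (i, y)) (x₂ := (i', y')) ⟨trivial, hy⟩ ⟨trivial, hy'⟩
      (congrArg Prod.snd h1)
    simp only [Prod.mk.injEq] at h1 h2 ⊢
    exact ⟨⟨h1.1, h2.1⟩, h2.2⟩
  · intro x hx
    obtain ⟨⟨j, z⟩, ⟨-, hz⟩, rfl⟩ := hs' hx
    obtain ⟨⟨i, y⟩, ⟨-, hy⟩, rfl⟩ := hs hz
    exact ⟨((j, i), y), ⟨trivial, hy⟩, rfl⟩

theorem IsMonomialTiling.congr (h : IsMonomialTiling ι D A) (e : κ ≃ ι) :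
    IsMonomialTiling κ D A := by
  obtain ⟨a, n, hm, hi, hs⟩ := h
  refine ⟨a ∘ e, n ∘ e, ?_, ?_, ?_⟩
  · rintro ⟨i, y⟩ ⟨-, hy⟩
    exact hm (x := (e i, y)) ⟨trivial, hy⟩
  · rintro ⟨i, y⟩ ⟨-, hy⟩ ⟨i', y'⟩ ⟨-, hy'⟩ h
    simpa using hi (x₁ := (e i, y)) (x₂ := (e i', y')) ⟨trivial, hy⟩ ⟨trivial, hy'⟩ h
  · intro x hx
    obtain ⟨⟨j, z⟩, ⟨-, hz⟩, rfl⟩ := hs hx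
    exact ⟨(e.symm j, z), ⟨trivial, hz⟩, by simp⟩

/-- Two tilings whose numbers of pieces add up to that of a third one assemble to a definable
bijection from two disjoint copies of the tiled set to itself. -/
theorem IsMonomialTiling.exists_definable_bijOn {K : Type*} [Field K] [Ring.CompatibleRing K]
    {A D : Set K} [Finite κ] {ι₀ ι₁ : Type*} [Nonempty ι₀]
    (hD : (∅ : Set K).Definable₁ Language.ring D)
    (h₀ : IsMonomialTiling ι₀ D A) (h₁ : IsMonomialTiling ι₁ D A) (h : IsMonomialTiling κ D A)
    (e : ι₀ ⊕ ι₁ ≃ κ) :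
    ∃ f : K × K → K,
      Set.BijOn f (({0} ×ˢ A) ∪ ({1} ×ˢ A)) A ∧
      Set.Definable (∅ : Set K) Language.ring
        {v : Fin 3 → K | (v 0, v 1) ∈ ({0} ×ˢ A) ∪ ({1} ×ˢ A) ∧ f (v 0, v 1) = v 2} := by
  obtain ⟨a₀, n₀, hm₀, hi₀, hs₀⟩ := h₀
  obtain ⟨a₁, n₁, hm₁, hi₁, hs₁⟩ := h₁
  obtain ⟨b, m, ht⟩ := h.congr e
  have : Finite (ι₀ ⊕ ι₁) := Finite.of_equiv κ e.symm
  let c : ι₀ ⊕ ι₁ → ℕ := Sum.elim (fun _ => 0) (fun _ => 1)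
  let a : ι₀ ⊕ ι₁ → ℕ := Sum.elim a₀ a₁
  let n : ι₀ ⊕ ι₁ → ℕ := Sum.elim n₀ n₁
  let s : (ι₀ ⊕ ι₁) × K → K × K := fun q => (c q.1, a q.1 * q.2 ^ n q.1)
  let t : (ι₀ ⊕ ι₁) × K → K := fun q => b q.1 * q.2 ^ m q.1
  have hs : Set.BijOn s (Set.univ ×ˢ D) (({0} ×ˢ A) ∪ ({1} ×ˢ A)) := by
    refine ⟨?_, ?_, ?_⟩
    · rintro ⟨i | i, y⟩ ⟨-, hy⟩
      · exact .inl ⟨by simp [s, c], hm₀ (x := (i, y)) ⟨trivial, hy⟩⟩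
      · exact .inr ⟨by simp [s, c], hm₁ (x := (i, y)) ⟨trivial, hy⟩⟩
    · rintro ⟨i | i, y⟩ ⟨-, hy⟩ ⟨i' | i', y'⟩ ⟨-, hy'⟩ heq
      · simpa using hi₀ (x₁ := (i, y)) (x₂ := (i', y')) ⟨trivial, hy⟩ ⟨trivial, hy'⟩
          (congrArg Prod.snd heq)
      · simp [s, c] at heq
      · simp [s, c] at heq
      · simpa using hi₁ (x₁ := (i, y)) (x₂ := (i', y')) ⟨trivial, hy⟩ ⟨trivial, hy'⟩
          (congrArg Prod.snd heq)
    · rintro ⟨u, x⟩ (⟨hu, hx⟩ | ⟨hu, hx⟩)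
      · obtain ⟨⟨i, y⟩, ⟨-, hy⟩, rfl⟩ := hs₀ hx
        exact ⟨(.inl i, y), ⟨trivial, hy⟩, by simpa [s, c, a, n] using hu.symm⟩
      · obtain ⟨⟨i, y⟩, ⟨-, hy⟩, rfl⟩ := hs₁ hx
        exact ⟨(.inr i, y), ⟨trivial, hy⟩, by simpa [s, c, a, n] using hu.symm⟩
  have hinv := hs.invOn_invFunOn
  refine ⟨t ∘ Function.invFunOn s (Set.univ ×ˢ D), ht.comp (hs.symm hinv.symm), ?_⟩
  have key : {v : Fin 3 → K | (v 0, v 1) ∈ ({0} ×ˢ A) ∪ ({1} ×ˢ A) ∧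
      (t ∘ Function.invFunOn s (Set.univ ×ˢ D)) (v 0, v 1) = v 2} =
      {v | ∃ i, ∃ y, y ∈ D ∧ v 0 = (c i : K) ∧ v 1 = a i * y ^ n i ∧ v 2 = b i * y ^ m i} := by
    ext v
    constructor
    · rintro ⟨hv, hv2⟩
      obtain ⟨⟨i, y⟩, hy, hq⟩ := hs.surjOn hv
      rw [← hq, Function.comp_apply, hinv.1 hy] at hv2
      simp only [s, Prod.mk.injEq] at hq
      exact ⟨i, y, hy.2, hq.1.symm, hq.2.symm, hv2.symm⟩
    · rintro ⟨i, y, hy, h0, h1, h2⟩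
      have hq : (v 0, v 1) = s (i, y) := by simp [s, h0, h1]
      have hy' : (i, y) ∈ (Set.univ ×ˢ D : Set ((ι₀ ⊕ ι₁) × K)) := ⟨trivial, hy⟩
      refine ⟨hq ▸ hs.mapsTo hy', ?_⟩
      rw [hq, Function.comp_apply, hinv.1 hy', h2]
  rw [key, Set.ofPred_exists]
  refine Set.definable_iUnion_of_finite fun i => Set.Definable.exists_snoc ?_
  refine .inter (hD.preimage_proj _) (.inter ?_ (.inter ?_ ?_))
  · convert! Ring.definable_freeCommRing_lift_eq (R := K) (FreeCommRing.of (0 : Fin 4)) (c i) using 2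
    simp
    rfl
  · convert! Ring.definable_freeCommRing_lift_eq (R := K)
      (FreeCommRing.of (1 : Fin 4)) (a i * FreeCommRing.of (3 : Fin 4) ^ n i) using 2
    simp
    rfl
  · convert! Ring.definable_freeCommRing_lift_eq (R := K)
      (FreeCommRing.of (2 : Fin 4)) (b i * FreeCommRing.of (3 : Fin 4) ^ m i) using 2
    simp
    rfl

end MonomialTiling

section AngularComponent

variable {p : ℕ} [hp : Fact p.Prime]

/-- For `u ≡ 1` modulo `p ^ k`, raising to the power `n` scales `u - 1` by `p ^ r`, up to a unit,
where `r < k` is the `p`-adic valuation of `n`. -/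
theorem PadicInt.exists_pow_sub_one_eq {k r n' : ℕ} (hr : r < k) (hn' : ¬p ∣ n') {u : ℤ_[p]}
    (hu : (p : ℤ_[p]) ^ k ∣ u - 1) :
    ∃ e : ℤ_[p], IsUnit e ∧ u ^ (p ^ r * n') - 1 = p ^ r * (u - 1) * e := by
  set n := p ^ r * n' with hn
  have hS : u - 1 ∣ ∑ i ∈ Finset.range n, u ^ i - n := by
    have : ∑ i ∈ Finset.range n, u ^ i - (n : ℤ_[p]) = ∑ i ∈ Finset.range n, (u ^ i - 1) := by
      simp
    rw [this]
    exact Finset.dvd_sum fun i _ => by simpa using sub_dvd_pow_sub_pow u 1 i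
  obtain ⟨t, ht⟩ := (pow_dvd_pow _ (Nat.succ_le_of_lt hr)).trans (hu.trans hS)
  refine ⟨n' + p * t, ?_, ?_⟩
  · rw [← not_not (a := IsUnit _), PadicInt.not_isUnit_iff, PadicInt.norm_lt_one_iff_dvd,
      dvd_add_left (dvd_mul_right _ _), ← PadicInt.norm_lt_one_iff_dvd,
      PadicInt.norm_natCast_lt_one_iff]
    exact hn'
  · rw [← mul_geom_sum, sub_eq_iff_eq_add.1 ht, hn, Nat.succ_eq_add_one]
    push_cast
    ring

theorem PadicInt.norm_pow_mul {r n' : ℕ} (hn' : ¬p ∣ n') :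
    ‖((p ^ r * n' : ℕ) : ℤ_[p])‖ = (p : ℝ) ^ (-r : ℤ) := by
  have : ‖(n' : ℤ_[p])‖ = 1 := by
    rw [PadicInt.norm_natCast_eq_one_iff]
    exact (Nat.Prime.coprime_iff_not_dvd hp.out).2 hn'
  push_cast
  rw [norm_mul, this, mul_one, PadicInt.norm_p_pow]

theorem PadicInt.bijOn_pow {k r n' : ℕ} (hr : r < k) (hn' : ¬p ∣ n') :
    Set.BijOn (fun u : ℤ_[p] => u ^ (p ^ r * n')) {u | (p : ℤ_[p]) ^ k ∣ u - 1}
      {u | (p : ℤ_[p]) ^ (k + r) ∣ u - 1} := by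
  have hp1 : (1 : ℝ) < p := mod_cast hp.out.one_lt
  have hp0 : (p : ℤ_[p]) ≠ 0 := mod_cast hp.out.ne_zero
  have hroot {w : ℤ_[p]} (hw : (p : ℤ_[p]) ^ (k + r) ∣ w - 1) :
      ‖w - 1‖ < ‖((p ^ r * n' : ℕ) : ℤ_[p])‖ ^ 2 := by
    rw [PadicInt.norm_pow_mul hn', ← zpow_natCast, ← zpow_mul]
    refine ((PadicInt.norm_le_pow_iff_dvd _ _).2 hw).trans_lt (zpow_lt_zpow_right₀ hp1 ?_)
    push_cast
    omega
  have hclose {u : ℤ_[p]} (hu : (p : ℤ_[p]) ^ k ∣ u - 1) :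
      ‖u - 1‖ < ‖((p ^ r * n' : ℕ) : ℤ_[p])‖ := by
    rw [PadicInt.norm_pow_mul hn']
    exact ((PadicInt.norm_le_pow_iff_dvd _ _).2 hu).trans_lt
      (zpow_lt_zpow_right₀ hp1 (by omega))
  have hmaps {u : ℤ_[p]} (hu : (p : ℤ_[p]) ^ k ∣ u - 1) :
      (p : ℤ_[p]) ^ (k + r) ∣ u ^ (p ^ r * n') - 1 := by
    obtain ⟨e, -, he⟩ := PadicInt.exists_pow_sub_one_eq hr hn' hu
    rw [he, add_comm, pow_add]
    exact (mul_dvd_mul_left _ hu).mul_right _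
  refine ⟨fun u hu => hmaps hu, fun u hu u' hu' h => ?_, fun w hw => ?_⟩
  · obtain ⟨z, -, -, hz⟩ := PadicInt.exists_pow_eq_of_norm_lt (hroot (hmaps hu))
    rw [hz u rfl (hclose hu), hz u' h.symm (hclose hu')]
  · obtain ⟨z, hz, hz1, -⟩ := PadicInt.exists_pow_eq_of_norm_lt (hroot hw)
    refine ⟨z, ?_, hz⟩
    rw [PadicInt.norm_pow_mul hn', PadicInt.norm_lt_pow_iff_norm_le_pow_sub_one] at hz1
    have hz2 : (p : ℤ_[p]) ^ (r + 1) ∣ z - 1 := by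
      rw [← PadicInt.norm_le_pow_iff_dvd]
      convert hz1 using 2
      push_cast
      ring
    obtain ⟨e, he, heq⟩ := PadicInt.exists_pow_sub_one_eq r.lt_succ_self hn' hz2
    rw [hz] at heq
    have hw' : (p : ℤ_[p]) ^ (k + r) ∣ w - 1 := hw
    rw [heq, he.dvd_mul_right, add_comm, pow_add] at hw'
    exact (mul_dvd_mul_iff_left (pow_ne_zero r hp0)).1 hw'

/-- Powers of exponent `n = p ^ r * n'`, times `p ^ j` for `j < n`, tile `angOneQ p (k + r)`. -/
theorem isMonomialTiling_angOneQ_pow {k r n' : ℕ} (hr : r < k) (hn' : ¬p ∣ n') :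
    IsMonomialTiling (Fin (p ^ r * n')) (angOneQ p k) (angOneQ p (k + r)) := by
  have hbij := PadicInt.bijOn_pow (p := p) hr hn'
  have hn : 0 < p ^ r * n' := by
    refine Nat.mul_pos (pow_pos hp.out.pos _) (Nat.pos_of_ne_zero ?_)
    rintro rfl
    exact hn' (dvd_zero p)
  set n := p ^ r * n'
  have hform (j m : ℕ) (u : ℤ_[p]) : ((p ^ j : ℕ) : ℚ_[p]) * ((p : ℚ_[p]) ^ m * u) ^ n =
      (p : ℚ_[p]) ^ (j + n * m) * ((u ^ n : ℤ_[p]) : ℚ_[p]) := by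
    push_cast
    ring
  refine ⟨fun j => p ^ (j : ℕ), fun _ => n, ?_, ?_, ?_⟩
  · rintro ⟨j, y⟩ ⟨-, hy⟩
    obtain ⟨m, u, hu, rfl⟩ := mem_angOneQ_iff.1 hy
    exact mem_angOneQ_iff.2 ⟨_, _, hbij.mapsTo hu, hform j m u⟩
  · rintro ⟨j, y⟩ ⟨-, hy⟩ ⟨j', y'⟩ ⟨-, hy'⟩ h
    obtain ⟨m, u, hu, rfl⟩ := mem_angOneQ_iff.1 hy
    obtain ⟨m', u', hu', rfl⟩ := mem_angOneQ_iff.1 hy'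
    simp only [hform] at h
    obtain ⟨h1, h2⟩ := PadicInt.pow_mul_inj
      (PadicInt.norm_eq_one_of_dvd_sub_one (by omega) (hbij.mapsTo hu))
      (PadicInt.norm_eq_one_of_dvd_sub_one (by omega) (hbij.mapsTo hu')) h
    have hj : (j : ℕ) = j' := by
      have := congrArg (· % n) h1
      simpa [Nat.mod_eq_of_lt j.2, Nat.mod_eq_of_lt j'.2] using this
    have hm : m = m' := by
      rw [hj] at h1
      exact Nat.eq_of_mul_eq_mul_left hn (Nat.add_left_cancel h1)
    rw [Fin.ext hj, hm, hbij.injOn hu hu' h2]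
  · intro x hx
    obtain ⟨m, w, hw, rfl⟩ := mem_angOneQ_iff.1 hx
    obtain ⟨u, hu, rfl⟩ := hbij.surjOn hw
    refine ⟨(⟨m % n, Nat.mod_lt _ hn⟩, (p : ℚ_[p]) ^ (m / n) * u),
      ⟨trivial, mem_angOneQ_iff.2 ⟨_, _, hu, rfl⟩⟩, ?_⟩
    simp only [hform, Nat.mod_add_div]

/-- The multiples of `angOneQ p (k + 1)` by `1 + j * p ^ k`, for `j < p`, tile `angOneQ p k`. -/
theorem isMonomialTiling_angOneQ_succ {k : ℕ} (hk : 1 ≤ k) :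
    IsMonomialTiling (Fin p) (angOneQ p (k + 1)) (angOneQ p k) := by
  have hp0 : (p : ℤ_[p]) ≠ 0 := mod_cast hp.out.ne_zero
  have hform (j m : ℕ) (u : ℤ_[p]) : ((1 + j * p ^ k : ℕ) : ℚ_[p]) * ((p : ℚ_[p]) ^ m * u) ^ 1 =
      (p : ℚ_[p]) ^ m * (((1 + j * p ^ k) * u : ℤ_[p]) : ℚ_[p]) := by
    push_cast
    ring
  have hmaps (j : ℕ) {u : ℤ_[p]} (hu : (p : ℤ_[p]) ^ (k + 1) ∣ u - 1) :
      (p : ℤ_[p]) ^ k ∣ (1 + j * p ^ k) * u - 1 := by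
    have : (1 + j * (p : ℤ_[p]) ^ k) * u - 1 = (u - 1) + p ^ k * (j * u) := by ring
    rw [this]
    exact dvd_add ((pow_dvd_pow _ k.le_succ).trans hu) (dvd_mul_right _ _)
  have hcoeff (j : ℕ) : IsUnit (1 + j * (p : ℤ_[p]) ^ k) :=
    PadicInt.isUnit_iff.2 (PadicInt.norm_eq_one_of_dvd_sub_one hk (by simp))
  refine ⟨fun j => 1 + j * p ^ k, fun _ => 1, ?_, ?_, ?_⟩
  · rintro ⟨j, y⟩ ⟨-, hy⟩
    obtain ⟨m, u, hu, rfl⟩ := mem_angOneQ_iff.1 hy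
    exact mem_angOneQ_iff.2 ⟨_, _, hmaps j hu, hform j m u⟩
  · rintro ⟨j, y⟩ ⟨-, hy⟩ ⟨j', y'⟩ ⟨-, hy'⟩ h
    obtain ⟨m, u, hu, rfl⟩ := mem_angOneQ_iff.1 hy
    obtain ⟨m', u', hu', rfl⟩ := mem_angOneQ_iff.1 hy'
    simp only [hform] at h
    obtain ⟨rfl, h2⟩ := PadicInt.pow_mul_inj
      (PadicInt.norm_eq_one_of_dvd_sub_one hk (hmaps j hu))
      (PadicInt.norm_eq_one_of_dvd_sub_one hk (hmaps j' hu')) h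
    have hj : (j : ℕ) = j' := by
      obtain ⟨t, ht⟩ := hu
      obtain ⟨t', ht'⟩ := hu'
      have h3 : (p : ℤ_[p]) ^ k * ((j : ℤ_[p]) - j') = (p : ℤ_[p]) ^ k *
          (p * ((1 + j' * p ^ k) * t' - (1 + j * p ^ k) * t)) := by
        linear_combination h2 - (1 + j * p ^ k) * ht + (1 + j' * p ^ k) * ht'
      have h4 := mul_left_cancel₀ (pow_ne_zero k hp0) h3
      have h5 := PadicInt.zmodRepr_unique (j : ℤ_[p]) j' j'.2 (by
        rw [PadicInt.maximalIdeal_eq_span_p, Ideal.mem_span_singleton, h4]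
        exact dvd_mul_right _ _)
      rw [← h5, PadicInt.zmodRepr_natCast_of_lt j.2]
    obtain rfl := Fin.ext hj
    rw [(hcoeff j).mul_left_cancel h2]
  · intro x hx
    obtain ⟨m, w, ⟨z, hz⟩, rfl⟩ := mem_angOneQ_iff.1 hx
    obtain ⟨u, hu⟩ := (hcoeff z.zmodRepr).dvd (a := w)
    refine ⟨(⟨z.zmodRepr, z.zmodRepr_lt_p⟩, (p : ℚ_[p]) ^ m * u),
      ⟨trivial, mem_angOneQ_iff.2 ⟨_, _, ?_, rfl⟩⟩, ?_⟩
    · obtain ⟨s, hs⟩ := (PadicInt.norm_lt_one_iff_dvd _).1 z.norm_sub_zmodRepr_lt_one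
      refine (hcoeff z.zmodRepr).dvd_mul_left.1 ⟨s, ?_⟩
      linear_combination hz - hu + (p : ℤ_[p]) ^ k * hs
    · simp only [hform, ← hu]

end AngularComponent

theorem exists_definable_bij_disjoint_union_Rk (p : ℕ) [Fact p.Prime]
    (k : ℕ) (hk : 1 ≤ k) :
    ∃ f : ℚ_[p] × ℚ_[p] → ℚ_[p],
      Set.BijOn f (({0} ×ˢ angOneQ p k) ∪ ({1} ×ˢ angOneQ p k)) (angOneQ p k) ∧
      Set.Definable (∅ : Set ℚ_[p]) Language.ring
        {v : Fin 3 → ℚ_[p] |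
          (v 0, v 1) ∈ ({0} ×ˢ angOneQ p k) ∪ ({1} ×ˢ angOneQ p k) ∧
            f (v 0, v 1) = v 2} := by
  have hp : p.Prime := Fact.out
  obtain rfl | hp2 := eq_or_ne p 2
  · have h := isMonomialTiling_angOneQ_succ (p := 2) hk
    have h' := isMonomialTiling_angOneQ_succ (p := 2) (k := k + 1) (by omega)
    have hsq := isMonomialTiling_angOneQ_pow (p := 2) (k := k + 1) (r := 1) (n' := 1)
      (by omega) (by norm_num)
    have hcube := isMonomialTiling_angOneQ_pow (p := 2) (k := k + 1) (r := 0) (n' := 3)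
      (by omega) (by norm_num)
    exact IsMonomialTiling.exists_definable_bijOn (definable₁_angOneQ _) h
      (hcube.trans h) ((hsq.trans h').trans h) (Fintype.equivOfCardEq (by simp))
  · have hsq := isMonomialTiling_angOneQ_pow (p := p) (k := k) (r := 0) (n' := 2) hk
      (fun h => hp2 ((Nat.prime_dvd_prime_iff_eq hp Nat.prime_two).1 h))
    exact IsMonomialTiling.exists_definable_bijOn (definable₁_angOneQ k) (.refl _) (.refl _)
      hsq (Fintype.equivOfCardEq (by simp))
end

section
/- For every prime p, there exists a bijection from (ℤ_p × ℤ_p) ∖ {(0,0)} onto ℤ_p × ℤ_p whose graph, viewed as a subset of ℚ_p⁴ (encoded as Set (Fin 4 → ℚ_p)), is ∅-definable in the first-order language of rings. -/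
open FirstOrder

namespace FirstOrder.Ring

open Set

section Definable

variable {R α : Type*} [Field R] [CompatibleRing R] {A : Set R} {f g : (α → R) → R}

theorem definableFun_add (hf : A.DefinableFun Language.ring f)
    (hg : A.DefinableFun Language.ring g) :
    A.DefinableFun Language.ring fun v => f v + g v := by
  have h : (∅ : Set R).DefinableFun Language.ring fun w : Fin 2 → R => w 0 + w 1 := by
    simpa only [funext CompatibleRing.funMap_add] using DefinableFun.fun_symbol (M := R) addFunc
  have hm : A.DefinableMap Language.ring fun v => ![f v, g v] := by
    simp [DefinableMap, *]
  exact h.of_empty.comp hm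

theorem definableFun_mul (hf : A.DefinableFun Language.ring f)
    (hg : A.DefinableFun Language.ring g) :
    A.DefinableFun Language.ring fun v => f v * g v := by
  have h : (∅ : Set R).DefinableFun Language.ring fun w : Fin 2 → R => w 0 * w 1 := by
    simpa only [funext CompatibleRing.funMap_mul] using DefinableFun.fun_symbol (M := R) mulFunc
  have hm : A.DefinableMap Language.ring fun v => ![f v, g v] := by
    simp [DefinableMap, *]
  exact h.of_empty.comp hm

theorem definableFun_neg (hf : A.DefinableFun Language.ring f) :
    A.DefinableFun Language.ring fun v => -f v := by
  have h : (∅ : Set R).DefinableFun Language.ring fun w : Fin 1 → R => -w 0 := by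
    simpa only [funext CompatibleRing.funMap_neg] using DefinableFun.fun_symbol (M := R) negFunc
  have hm : A.DefinableMap Language.ring fun v => ![f v] := by
    simp [DefinableMap, *]
  exact h.of_empty.comp hm

theorem definableFun_sub (hf : A.DefinableFun Language.ring f)
    (hg : A.DefinableFun Language.ring g) :
    A.DefinableFun Language.ring fun v => f v - g v := by
  simpa only [sub_eq_add_neg] using definableFun_add hf (definableFun_neg hg)

theorem definableFun_zero : A.DefinableFun Language.ring fun _ : α → R => 0 := by
  have h := (0 : Language.ring.Term α).definableFun_realize (M := R)
  simp only [realize_zero] at h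
  exact h.of_empty

theorem definableFun_one : A.DefinableFun Language.ring fun _ : α → R => 1 := by
  have h := (1 : Language.ring.Term α).definableFun_realize (M := R)
  simp only [realize_one] at h
  exact h.of_empty

theorem definableFun_natCast (n : ℕ) :
    A.DefinableFun Language.ring fun _ : α → R => (n : R) := by
  induction n with
  | zero => simpa using! definableFun_zero
  | succ n ih => simpa using! definableFun_add ih definableFun_one

theorem definableFun_pow (hf : A.DefinableFun Language.ring f) (n : ℕ) :
    A.DefinableFun Language.ring fun v => f v ^ n := by
  induction n with
  | zero => simpa using! definableFun_one
  | succ n ih => simpa only [pow_succ] using definableFun_mul ih hf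

theorem definableFun_inv (hf : A.DefinableFun Language.ring f) :
    A.DefinableFun Language.ring fun v => (f v)⁻¹ := by
  have h : A.DefinableFun Language.ring fun w : Fin 1 → R => (w 0)⁻¹ := by
    have h₁ : A.Definable Language.ring {w : Option (Fin 1) → R | w (some 0) * w none = 1} :=
      (definableFun_mul (.proj _) (.proj _)).ofPred_eq definableFun_one
    have h₂ : A.Definable Language.ring {w : Option (Fin 1) → R | w (some 0) = 0} :=
      DefinableFun.ofPred_eq (.proj _) definableFun_zero
    have h₃ : A.Definable Language.ring {w : Option (Fin 1) → R | w none = 0} :=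
      DefinableFun.ofPred_eq (.proj _) definableFun_zero
    rw [DefinableFun]
    convert! h₁.union (h₂.inter h₃) using 1
    ext w
    by_cases hw : w (some 0) = 0
    · simp [Function.tupleGraph, hw, eq_comm]
    · simp [Function.tupleGraph, hw, mul_comm (w (some 0)), mul_eq_one_iff_eq_inv₀ hw,
        eq_comm (a := w none)]
  have hm : A.DefinableMap Language.ring fun v => ![f v] := by
    simp [DefinableMap, *]
  exact h.comp hm

theorem definableFun_div (hf : A.DefinableFun Language.ring f)
    (hg : A.DefinableFun Language.ring g) :
    A.DefinableFun Language.ring fun v => f v / g v := by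
  simpa only [div_eq_mul_inv] using definableFun_mul hf (definableFun_inv hg)

theorem definable_exists_pow_eq [Finite α] (hf : A.DefinableFun Language.ring f) (n : ℕ) :
    A.Definable Language.ring {v | ∃ y, y ^ n = f v} := by
  have hm : A.DefinableMap Language.ring fun (w : α ⊕ Fin 1 → R) => w ∘ Sum.inl :=
    fun i => .proj _
  have h : A.Definable Language.ring
      {w : α ⊕ Fin 1 → R | w (Sum.inr 0) ^ n = f (w ∘ Sum.inl)} :=
    (definableFun_pow (.proj _) n).ofPred_eq (hf.comp hm)
  convert! h.exists_of_finite using 1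
  ext v
  simp only [mem_ofPred_eq, Sum.elim_inr, Sum.elim_comp_inl]
  exact ⟨fun ⟨y, hy⟩ => ⟨fun _ => y, hy⟩, fun ⟨y, hy⟩ => ⟨y 0, hy⟩⟩

end Definable

end FirstOrder.Ring

namespace Padic
open Set FirstOrder FirstOrder.Ring

variable {p : ℕ} [hp : Fact p.Prime]

theorem norm_div_prime_le_one_iff {x : ℚ_[p]} : ‖x / p‖ ≤ 1 ↔ ‖x‖ < 1 := by
  have h := Padic.norm_le_pow_iff_norm_lt_pow_add_one x (-1)
  have hp0 : (0 : ℝ) < p := mod_cast hp.out.pos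
  simp only [neg_add_cancel, zpow_zero, zpow_neg_one] at h
  rw [← h, norm_div, Padic.norm_p, div_le_iff₀ (inv_pos.2 hp0), one_mul]

theorem exists_pow_eq_of_norm_sub_one_lt {n : ℕ} (hn : p.Coprime n) {u : ℚ_[p]}
    (hu : ‖u - 1‖ < 1) : ∃ y, y ^ n = u := by
  have hu1 : ‖u‖ ≤ 1 := by
    simpa using (Padic.nonarchimedean (u - 1) 1).trans (max_le hu.le (by simp))
  have hn1 : ‖(n : ℤ_[p])‖ = 1 := PadicInt.norm_natCast_eq_one_iff.2 hn
  obtain ⟨u, rfl⟩ : ∃ z : ℤ_[p], (z : ℚ_[p]) = u := ⟨⟨u, hu1⟩, rfl⟩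
  let F : Polynomial ℤ_[p] := .X ^ n - .C u
  have hF : ‖F.aeval (1 : ℤ_[p])‖ < ‖F.derivative.aeval (1 : ℤ_[p])‖ ^ 2 := by
    have : ‖1 - u‖ < 1 := by
      rw [norm_sub_rev]
      exact_mod_cast hu
    simpa [F, hn1, Polynomial.derivative_X_pow] using this
  obtain ⟨z, hz, -⟩ := hensels_lemma hF
  refine ⟨z, ?_⟩
  have : z ^ n = u := by simpa [F, sub_eq_zero] using hz
  rw [← this, PadicInt.coe_pow]

theorem norm_pow_card_sub_one_sub_one_lt {y : ℚ_[p]} (hy : ‖y‖ = 1) :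
    ‖y ^ (p - 1) - 1‖ < 1 := by
  obtain ⟨z, rfl⟩ : ∃ z : ℤ_[p], (z : ℚ_[p]) = y := ⟨⟨y, hy.le⟩, rfl⟩
  have hz : PadicInt.toZMod z ≠ 0 := by
    rw [Ne, ← RingHom.mem_ker, PadicInt.ker_toZMod, IsLocalRing.mem_maximalIdeal,
      mem_nonunits_iff, not_not, PadicInt.isUnit_iff]
    exact hy
  have h : z ^ (p - 1) - 1 ∈ IsLocalRing.maximalIdeal ℤ_[p] := by
    rw [← PadicInt.ker_toZMod, RingHom.mem_ker, map_sub, map_pow, map_one,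
      ZMod.pow_card_sub_one_eq_one hz, sub_self]
  have := PadicInt.mem_nonunits.1 h
  exact_mod_cast this

/-- The ring of integers of `ℚ_[p]` is defined by the solvability of
`y ^ (p + 1) = 1 + p * x ^ (p + 1)`. -/
theorem norm_le_one_iff_exists_pow_eq_s12 {x : ℚ_[p]} :
    ‖x‖ ≤ 1 ↔ ∃ y, y ^ (p + 1) = 1 + p * x ^ (p + 1) := by
  have hp0 : (0 : ℝ) < p := mod_cast hp.out.pos
  have hp1 : (1 : ℝ) < p := mod_cast hp.out.one_lt
  constructor
  · intro hx
    refine exists_pow_eq_of_norm_sub_one_lt (by simp) ?_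
    rw [add_sub_cancel_left, norm_mul, norm_pow]
    exact mul_lt_one_of_nonneg_of_lt_one_left (norm_nonneg _) Padic.norm_p_lt_one
      (pow_le_one₀ (norm_nonneg _) hx)
  · rintro ⟨y, hy⟩
    by_contra! hx
    have hx0 : x ≠ 0 := norm_pos_iff.1 (one_pos.trans hx)
    have h1 : 1 < ‖(p : ℚ_[p]) * x ^ (p + 1)‖ := by
      have hxp : (p : ℝ) ≤ ‖x‖ := by
        have := (Padic.norm_le_pow_iff_norm_lt_pow_add_one x 0).not.1 (by simpa using hx)
        simpa using this
      rw [norm_mul, norm_pow, Padic.norm_p, pow_succ']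
      calc (1 : ℝ) < ‖x‖ ^ p := one_lt_pow₀ hx hp.out.ne_zero
        _ = (p : ℝ)⁻¹ * (p * ‖x‖ ^ p) := by field_simp
        _ ≤ _ := by gcongr
    have h2 : ‖y‖ ^ (p + 1) = (p : ℝ)⁻¹ * ‖x‖ ^ (p + 1) := by
      rw [← norm_pow, hy, IsUltrametricDist.norm_add_eq_max_of_norm_ne_norm
        (by simpa using h1.ne), norm_one, max_eq_right h1.le, norm_mul, norm_pow, Padic.norm_p]
    have h3 : ‖y / x‖ ^ (p + 1) = (p : ℝ)⁻¹ := by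
      have : ‖x‖ ≠ 0 := norm_ne_zero_iff.2 hx0
      rw [norm_div, div_pow, h2]
      field_simp
    have h4 : y / x ≠ 0 := by
      intro h
      rw [h] at h3
      simp [hp0.ne] at h3
    rw [Padic.norm_eq_zpow_neg_valuation h4, ← zpow_natCast, ← zpow_mul, ← zpow_neg_one] at h3
    have h5 := zpow_right_injective₀ hp0 hp1.ne' h3
    have h6 : ((p + 1 : ℕ) : ℤ) ∣ 1 := ⟨(y / x).valuation, by linarith⟩
    have h7 := Nat.dvd_one.1 (by exact_mod_cast h6)
    have := hp.out.pos
    lia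

theorem definable_norm_le_one {α : Type*} [Finite α] {A : Set ℚ_[p]} {f : (α → ℚ_[p]) → ℚ_[p]}
    (hf : A.DefinableFun Language.ring f) :
    A.Definable Language.ring {v | ‖f v‖ ≤ 1} := by
  simpa only [norm_le_one_iff_exists_pow_eq_s12] using definable_exists_pow_eq
    (definableFun_add definableFun_one
      (definableFun_mul (definableFun_natCast p) (definableFun_pow hf (p + 1)))) (p + 1)

variable (p) in
/-- The punctured disc minus the ball `1 + p ℤ_[p]` is the image of the punctured disc under this
map, which multiplies the `(p - 1)`-st powers by `p ^ (p - 1)`. -/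
noncomputable def dilate (x : ℚ_[p]) : ℚ_[p] :=
  open Classical in if ∃ y, y ^ (p - 1) = x then (p : ℚ_[p]) ^ (p - 1) * x else x

variable (p) in
/-- The inverse of `Padic.dilate`. -/
noncomputable def contract (x : ℚ_[p]) : ℚ_[p] :=
  open Classical in if ∃ y, y ^ (p - 1) = x then x / (p : ℚ_[p]) ^ (p - 1) else x

theorem prime_ne_zero : (p : ℚ_[p]) ≠ 0 := mod_cast hp.out.ne_zero

theorem prime_pow_ne_zero : (p : ℚ_[p]) ^ (p - 1) ≠ 0 := pow_ne_zero _ prime_ne_zero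

@[simp]
theorem contract_dilate (x : ℚ_[p]) : contract p (dilate p x) = x := by
  by_cases h : ∃ y, y ^ (p - 1) = x
  · have h' : ∃ y, y ^ (p - 1) = (p : ℚ_[p]) ^ (p - 1) * x :=
      h.imp' (p * ·) fun y hy => by rw [mul_pow, hy]
    rw [dilate, if_pos h, contract, if_pos h', mul_div_cancel_left₀ _ prime_pow_ne_zero]
  · rw [dilate, if_neg h, contract, if_neg h]

@[simp]
theorem dilate_contract (x : ℚ_[p]) : dilate p (contract p x) = x := by
  by_cases h : ∃ y, y ^ (p - 1) = x
  · have h' : ∃ y, y ^ (p - 1) = x / (p : ℚ_[p]) ^ (p - 1) :=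
      h.imp' (· / p) fun y hy => by rw [div_pow, hy]
    rw [contract, if_pos h, dilate, if_pos h', mul_div_cancel₀ _ prime_pow_ne_zero]
  · rw [contract, if_neg h, dilate, if_neg h]

theorem dilate_ne_zero {x : ℚ_[p]} (hx : x ≠ 0) : dilate p x ≠ 0 := by
  unfold dilate
  split_ifs
  · exact mul_ne_zero prime_pow_ne_zero hx
  · exact hx

theorem contract_ne_zero {x : ℚ_[p]} (hx : x ≠ 0) : contract p x ≠ 0 := by
  unfold contract
  split_ifs
  · exact div_ne_zero hx prime_pow_ne_zero
  · exact hx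

theorem norm_dilate_le_one {x : ℚ_[p]} (hx : ‖x‖ ≤ 1) : ‖dilate p x‖ ≤ 1 := by
  unfold dilate
  split_ifs
  · rw [norm_mul, norm_pow]
    exact mul_le_one₀ (pow_le_one₀ (norm_nonneg _) norm_p_lt_one.le) (norm_nonneg _) hx
  · exact hx

theorem norm_eq_one_of_norm_sub_one_lt {x : ℚ_[p]} (hx : ‖x - 1‖ < 1) : ‖x‖ = 1 := by
  have := IsUltrametricDist.norm_add_eq_max_of_norm_ne_norm (x := x - 1) (y := 1)
    (by simpa using hx.ne)
  rwa [sub_add_cancel, norm_one, max_eq_right hx.le] at this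

theorem not_norm_dilate_sub_one_div_le {x : ℚ_[p]} (hx : ‖x‖ ≤ 1) :
    ¬‖(dilate p x - 1) / p‖ ≤ 1 := by
  rw [norm_div_prime_le_one_iff]
  intro h
  have h1 := norm_eq_one_of_norm_sub_one_lt h
  have hcop : p.Coprime (p - 1) :=
    (Nat.coprime_self_sub_right hp.out.one_le).2 (Nat.coprime_one_right p)
  by_cases hp' : ∃ y, y ^ (p - 1) = x
  · rw [dilate, if_pos hp', norm_mul, norm_pow] at h1
    have h2 : ‖(p : ℚ_[p])‖ ^ (p - 1) < 1 :=
      pow_lt_one₀ (norm_nonneg _) norm_p_lt_one (Nat.sub_pos_of_lt hp.out.one_lt).ne'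
    exact (mul_lt_one_of_nonneg_of_lt_one_left (by positivity) h2 hx).ne h1
  · rw [dilate, if_neg hp'] at h
    exact hp' (exists_pow_eq_of_norm_sub_one_lt hcop h)

theorem norm_contract_le_one {x : ℚ_[p]} (hx : ‖x‖ ≤ 1) (hx1 : ¬‖(x - 1) / p‖ ≤ 1) :
    ‖contract p x‖ ≤ 1 := by
  rw [norm_div_prime_le_one_iff] at hx1
  unfold contract
  split_ifs with h
  · obtain ⟨y, rfl⟩ := h
    have hp1 : p - 1 ≠ 0 := (Nat.sub_pos_of_lt hp.out.one_lt).ne'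
    rw [norm_pow, pow_le_one_iff_of_nonneg (norm_nonneg _) hp1] at hx
    rw [← div_pow, norm_pow]
    refine pow_le_one₀ (norm_nonneg _) (norm_div_prime_le_one_iff.2 (hx.lt_of_ne fun hy => ?_))
    exact hx1 (norm_pow_card_sub_one_sub_one_lt hy)
  · exact hx

variable (p) in
/-- A bijection from the product of the closed unit disc with itself to the product of the
punctured disc with the disc. -/
noncomputable def removeAxis (z : ℚ_[p] × ℚ_[p]) : ℚ_[p] × ℚ_[p] :=
  open Classical in if z.1 = 0 then (1 + p * z.2, 0) else if z.2 = 0 then (dilate p z.1, 0) else z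

variable (p) in
/-- The inverse of `Padic.removeAxis`. -/
noncomputable def restoreAxis (z : ℚ_[p] × ℚ_[p]) : ℚ_[p] × ℚ_[p] :=
  open Classical in if z.2 = 0 then
    if ‖(z.1 - 1) / p‖ ≤ 1 then (0, (z.1 - 1) / p) else (contract p z.1, 0)
  else z

variable (p) in
/-- A bijection from the product of the punctured disc with the disc to the product of the disc
with itself minus the origin. -/
noncomputable def glue (z : ℚ_[p] × ℚ_[p]) : ℚ_[p] × ℚ_[p] :=
  open Classical in if ‖(z.1 - 1) / p‖ ≤ 1 then
    (p * (removeAxis p ((z.1 - 1) / p, z.2)).1 * (removeAxis p ((z.1 - 1) / p, z.2)).2,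
      (removeAxis p ((z.1 - 1) / p, z.2)).1)
  else (contract p z.1, contract p z.1 * z.2)

variable (p) in
/-- The inverse of `Padic.glue`. -/
noncomputable def unglue (z : ℚ_[p] × ℚ_[p]) : ℚ_[p] × ℚ_[p] :=
  open Classical in if z.1 ≠ 0 ∧ ‖z.2 / z.1‖ ≤ 1 then (dilate p z.1, z.2 / z.1)
  else
    (1 + p * (restoreAxis p (z.2, z.1 / (p * z.2))).1,
      (restoreAxis p (z.2, z.1 / (p * z.2))).2)

theorem norm_one_add_prime_mul {x : ℚ_[p]} (hx : ‖x‖ ≤ 1) : ‖1 + p * x‖ = 1 := by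
  refine norm_eq_one_of_norm_sub_one_lt ?_
  rw [add_sub_cancel_left, norm_mul]
  exact mul_lt_one_of_nonneg_of_lt_one_left (norm_nonneg _) norm_p_lt_one hx

theorem one_add_prime_mul_ne_zero {x : ℚ_[p]} (hx : ‖x‖ ≤ 1) : 1 + p * x ≠ 0 :=
  norm_ne_zero_iff.1 (by simp [norm_one_add_prime_mul hx])

theorem mapsTo_removeAxis :
    MapsTo (removeAxis p) ({x | ‖x‖ ≤ 1} ×ˢ {x | ‖x‖ ≤ 1})
      ({x | x ≠ 0 ∧ ‖x‖ ≤ 1} ×ˢ {x | ‖x‖ ≤ 1}) := by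
  rintro ⟨x, y⟩ ⟨hx, hy⟩
  simp only [mem_ofPred_eq] at hx hy
  by_cases hx0 : x = 0
  · simp [removeAxis, hx0, one_add_prime_mul_ne_zero hy, norm_one_add_prime_mul hy]
  by_cases hy0 : y = 0
  · simp [removeAxis, hx0, hy0, dilate_ne_zero hx0, norm_dilate_le_one hx]
  · simp [removeAxis, hx0, hy0, hx, hy]

theorem mapsTo_restoreAxis :
    MapsTo (restoreAxis p) ({x | x ≠ 0 ∧ ‖x‖ ≤ 1} ×ˢ {x | ‖x‖ ≤ 1})
      ({x | ‖x‖ ≤ 1} ×ˢ {x | ‖x‖ ≤ 1}) := by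
  rintro ⟨x, y⟩ ⟨⟨hx0, hx⟩, hy⟩
  simp only [mem_ofPred_eq] at hx hy
  by_cases hy0 : y = 0
  · by_cases hx1 : ‖(x - 1) / p‖ ≤ 1
    · simp only [restoreAxis, hy0, hx1, if_true]
      simp [- norm_div, hx1]
    · simp only [restoreAxis, hy0, hx1, if_true, if_false]
      simp [norm_contract_le_one hx hx1]
  · simp [restoreAxis, hy0, hx, hy]

theorem leftInvOn_restoreAxis :
    LeftInvOn (restoreAxis p) (removeAxis p) ({x | ‖x‖ ≤ 1} ×ˢ {x | ‖x‖ ≤ 1}) := by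
  rintro ⟨x, y⟩ ⟨hx, hy⟩
  simp only [mem_ofPred_eq] at hx hy
  by_cases hx0 : x = 0
  · simp [removeAxis, restoreAxis, hx0, mul_div_cancel_left₀ _ prime_ne_zero, hy, - norm_div]
  by_cases hy0 : y = 0
  · simp [removeAxis, restoreAxis, hx0, hy0, not_norm_dilate_sub_one_div_le hx, - norm_div]
  · simp [removeAxis, restoreAxis, hx0, hy0]

theorem rightInvOn_restoreAxis :
    RightInvOn (restoreAxis p) (removeAxis p)
      ({x | x ≠ 0 ∧ ‖x‖ ≤ 1} ×ˢ {x | ‖x‖ ≤ 1}) := by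
  rintro ⟨x, y⟩ ⟨⟨hx0, hx⟩, hy⟩
  simp only [mem_ofPred_eq] at hx hy
  by_cases hy0 : y = 0
  · by_cases hx1 : ‖(x - 1) / p‖ ≤ 1
    · simp only [restoreAxis, hy0, hx1, if_true]
      simp [removeAxis, mul_div_cancel₀ _ prime_ne_zero]
    · simp only [restoreAxis, hy0, hx1, if_true, if_false]
      simp [removeAxis, contract_ne_zero hx0]
  · simp [restoreAxis, removeAxis, hy0, hx0]

theorem bijOn_restoreAxis :
    BijOn (restoreAxis p) ({x | x ≠ 0 ∧ ‖x‖ ≤ 1} ×ˢ {x | ‖x‖ ≤ 1})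
      ({x | ‖x‖ ≤ 1} ×ˢ {x | ‖x‖ ≤ 1}) :=
  InvOn.bijOn ⟨rightInvOn_restoreAxis, leftInvOn_restoreAxis⟩ mapsTo_restoreAxis
    mapsTo_removeAxis

theorem mapsTo_glue :
    MapsTo (glue p) ({x | x ≠ 0 ∧ ‖x‖ ≤ 1} ×ˢ {x | ‖x‖ ≤ 1})
      (({x | ‖x‖ ≤ 1} ×ˢ {x | ‖x‖ ≤ 1}) \ {(0, 0)}) := by
  rintro ⟨x, y⟩ ⟨⟨hx0, hx⟩, hy⟩
  simp only [mem_ofPred_eq] at hx hy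
  by_cases hx1 : ‖(x - 1) / p‖ ≤ 1
  · obtain ⟨⟨h0, h1⟩, h2⟩ := mapsTo_removeAxis (mk_mem_prod hx1 hy)
    simp only [mem_ofPred_eq] at h1 h2
    rw [glue, if_pos hx1]
    refine ⟨⟨?_, h1⟩, fun h => h0 (congrArg Prod.snd h)⟩
    simp only [mem_ofPred_eq, norm_mul]
    exact mul_le_one₀ (mul_le_one₀ norm_p_lt_one.le (norm_nonneg _) h1) (norm_nonneg _) h2
  · rw [glue, if_neg hx1]
    have h1 := norm_contract_le_one hx hx1
    refine ⟨⟨h1, ?_⟩, fun h => contract_ne_zero hx0 (congrArg Prod.fst h)⟩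
    simp only [mem_ofPred_eq, norm_mul]
    exact mul_le_one₀ h1 (norm_nonneg _) hy

theorem mem_of_not_norm_div_le {x y : ℚ_[p]} (hy : ‖y‖ ≤ 1)
    (h0 : (x, y) ≠ (0, 0)) (h : ¬(x ≠ 0 ∧ ‖y / x‖ ≤ 1)) :
    (y, x / (p * y)) ∈ ({x | x ≠ 0 ∧ ‖x‖ ≤ 1} ×ˢ {x | ‖x‖ ≤ 1} : Set (ℚ_[p] × ℚ_[p])) := by
  have hy0 : y ≠ 0 := by
    rintro rfl
    by_cases hx : x = 0 <;> simp [hx] at h0 h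
  refine ⟨⟨hy0, hy⟩, ?_⟩
  simp only [mem_ofPred_eq]
  rw [mul_comm, ← div_div, norm_div_prime_le_one_iff, norm_div, div_lt_one (norm_pos_iff.2 hy0)]
  by_cases hx : x = 0
  · simpa [hx] using hy0
  · have := not_le.1 (not_and.1 h hx)
    rwa [norm_div, one_lt_div (norm_pos_iff.2 hx)] at this

theorem mapsTo_unglue :
    MapsTo (unglue p) (({x | ‖x‖ ≤ 1} ×ˢ {x | ‖x‖ ≤ 1}) \ {(0, 0)})
      ({x | x ≠ 0 ∧ ‖x‖ ≤ 1} ×ˢ {x | ‖x‖ ≤ 1}) := by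
  rintro ⟨x, y⟩ ⟨⟨hx, hy⟩, h0⟩
  simp only [mem_ofPred_eq] at hx hy
  by_cases h : x ≠ 0 ∧ ‖y / x‖ ≤ 1
  · rw [unglue, if_pos h]
    exact ⟨⟨dilate_ne_zero h.1, norm_dilate_le_one hx⟩, h.2⟩
  · rw [unglue, if_neg h]
    obtain ⟨h1, h2⟩ := mapsTo_restoreAxis (mem_of_not_norm_div_le hy h0 h)
    exact ⟨⟨one_add_prime_mul_ne_zero h1, (norm_one_add_prime_mul h1).le⟩, h2⟩

theorem leftInvOn_unglue :
    LeftInvOn (unglue p) (glue p) ({x | x ≠ 0 ∧ ‖x‖ ≤ 1} ×ˢ {x | ‖x‖ ≤ 1}) := by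
  rintro ⟨x, y⟩ ⟨⟨hx0, hx⟩, hy⟩
  simp only [mem_ofPred_eq] at hx hy
  by_cases hx1 : ‖(x - 1) / p‖ ≤ 1
  · have hm := mk_mem_prod (s := {x : ℚ_[p] | ‖x‖ ≤ 1}) (t := {x : ℚ_[p] | ‖x‖ ≤ 1}) hx1 hy
    have hl := leftInvOn_restoreAxis hm
    obtain ⟨⟨h0, h1⟩, h2⟩ := mapsTo_removeAxis hm
    simp only [mem_ofPred_eq] at h1 h2
    rw [glue, if_pos hx1]
    simp only
    generalize removeAxis p ((x - 1) / p, y) = w at *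
    obtain ⟨a, b⟩ := w
    simp only at h0 h1 h2 ⊢
    have hn : ¬(p * a * b ≠ 0 ∧ ‖a / (p * a * b)‖ ≤ 1) := by
      rintro ⟨hab, h⟩
      have hb : b ≠ 0 := right_ne_zero_of_mul hab
      have : a / (p * a * b) = (p * b)⁻¹ := by
        field_simp [prime_ne_zero]
      rw [this, norm_inv, norm_mul, inv_le_one_iff₀] at h
      have hlt := mul_lt_one_of_nonneg_of_lt_one_left (norm_nonneg _) (norm_p_lt_one (p := p)) h2
      rcases h with h | h
      · exact h.not_gt (by rw [← norm_mul]; exact norm_pos_iff.2 (mul_ne_zero prime_ne_zero hb))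
      · exact h.not_gt hlt
    have he : p * a * b / (p * a) = b := mul_div_cancel_left₀ _ (mul_ne_zero prime_ne_zero h0)
    rw [unglue, if_neg hn]
    simp only [he, hl, mul_div_cancel₀ _ prime_ne_zero, add_sub_cancel]
  · have hc := contract_ne_zero hx0
    have he : contract p x * y / contract p x = y := mul_div_cancel_left₀ _ hc
    rw [glue, if_neg hx1, unglue, if_pos (by simpa only [he] using ⟨hc, hy⟩)]
    simp only [he, dilate_contract]

theorem rightInvOn_unglue :
    RightInvOn (unglue p) (glue p) (({x | ‖x‖ ≤ 1} ×ˢ {x | ‖x‖ ≤ 1}) \ {(0, 0)}) := by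
  rintro ⟨x, y⟩ ⟨⟨hx, hy⟩, h0⟩
  simp only [mem_ofPred_eq] at hx hy
  by_cases h : x ≠ 0 ∧ ‖y / x‖ ≤ 1
  · rw [unglue, if_pos h, glue, if_neg (not_norm_dilate_sub_one_div_le hx)]
    simp only [contract_dilate, mul_div_cancel₀ _ h.1]
  · have hm := mem_of_not_norm_div_le hy h0 h
    have hr := rightInvOn_restoreAxis hm
    obtain ⟨h1, h2⟩ := mapsTo_restoreAxis hm
    rw [unglue, if_neg h]
    generalize restoreAxis p (y, x / (p * y)) = w at *
    obtain ⟨a, b⟩ := w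
    simp only [mem_ofPred_eq] at h1 h2
    have he : (1 + p * a - 1) / p = a := by
      rw [add_sub_cancel_left, mul_div_cancel_left₀ _ prime_ne_zero]
    rw [glue, if_pos (by rwa [he])]
    simp only [he, hr]
    rw [mul_div_cancel₀ _ (mul_ne_zero prime_ne_zero hm.1.1)]

theorem bijOn_unglue :
    BijOn (unglue p) (({x | ‖x‖ ≤ 1} ×ˢ {x | ‖x‖ ≤ 1}) \ {(0, 0)})
      ({x | x ≠ 0 ∧ ‖x‖ ≤ 1} ×ˢ {x | ‖x‖ ≤ 1}) :=
  InvOn.bijOn ⟨rightInvOn_unglue, leftInvOn_unglue⟩ mapsTo_unglue mapsTo_glue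

section Definable

variable {α : Type*} [Finite α] {A : Set ℚ_[p]} {f g : (α → ℚ_[p]) → ℚ_[p]}

theorem definableFun_dilate (hf : A.DefinableFun Language.ring f) :
    A.DefinableFun Language.ring fun v => dilate p (f v) :=
  open Classical in DefinableFun.ite (definable_exists_pow_eq hf (p - 1))
    (definableFun_mul (definableFun_pow (definableFun_natCast p) _) hf) hf

theorem definableFun_contract (hf : A.DefinableFun Language.ring f) :
    A.DefinableFun Language.ring fun v => contract p (f v) :=
  open Classical in DefinableFun.ite (definable_exists_pow_eq hf (p - 1))
    (definableFun_div hf (definableFun_pow (definableFun_natCast p) _)) hf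

theorem definableFun_restoreAxis (hf : A.DefinableFun Language.ring f)
    (hg : A.DefinableFun Language.ring g) :
    (A.DefinableFun Language.ring fun v => (restoreAxis p (f v, g v)).1) ∧
      A.DefinableFun Language.ring fun v => (restoreAxis p (f v, g v)).2 := by
  classical
  have h₀ : A.Definable Language.ring {v | g v = 0} := hg.ofPred_eq definableFun_zero
  have hd : A.DefinableFun Language.ring fun v => (f v - 1) / p :=
    definableFun_div (definableFun_sub hf definableFun_one) (definableFun_natCast p)
  have h₁ := definable_norm_le_one hd
  simp only [restoreAxis, apply_ite Prod.fst, apply_ite Prod.snd]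
  exact ⟨.ite h₀ (.ite h₁ definableFun_zero (definableFun_contract hf)) hf,
    .ite h₀ (.ite h₁ hd definableFun_zero) hg⟩

theorem definableFun_unglue (hf : A.DefinableFun Language.ring f)
    (hg : A.DefinableFun Language.ring g) :
    (A.DefinableFun Language.ring fun v => (unglue p (f v, g v)).1) ∧
      A.DefinableFun Language.ring fun v => (unglue p (f v, g v)).2 := by
  classical
  have hd := definableFun_div hg hf
  have h₀ : A.Definable Language.ring {v | f v ≠ 0 ∧ ‖g v / f v‖ ≤ 1} :=
    (hf.ofPred_eq definableFun_zero).compl.inter (definable_norm_le_one hd)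
  have hr := definableFun_restoreAxis hg
    (definableFun_div hf (definableFun_mul (definableFun_natCast p) hg))
  simp only [unglue, apply_ite Prod.fst, apply_ite Prod.snd]
  exact ⟨.ite h₀ (definableFun_dilate hf)
      (definableFun_add definableFun_one (definableFun_mul (definableFun_natCast p) hr.1)),
    .ite h₀ hd hr.2⟩

end Definable

end Padic

theorem exists_definable_bij_plane_minus_point (p : ℕ) [Fact p.Prime] :
    ∃ f : ℚ_[p] × ℚ_[p] → ℚ_[p] × ℚ_[p],
      Set.BijOn f
        (({x : ℚ_[p] | ‖x‖ ≤ 1} ×ˢ {x : ℚ_[p] | ‖x‖ ≤ 1}) \ {(0, 0)})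
        ({x : ℚ_[p] | ‖x‖ ≤ 1} ×ˢ {x : ℚ_[p] | ‖x‖ ≤ 1}) ∧
      Set.Definable (∅ : Set ℚ_[p]) Language.ring
        {v : Fin 4 → ℚ_[p] |
          (v 0, v 1) ∈ ({x : ℚ_[p] | ‖x‖ ≤ 1} ×ˢ {x : ℚ_[p] | ‖x‖ ≤ 1}) \ {(0, 0)} ∧
            f (v 0, v 1) = (v 2, v 3)} := by
  refine ⟨Padic.restoreAxis p ∘ Padic.unglue p,
    Padic.bijOn_restoreAxis.comp Padic.bijOn_unglue, ?_⟩
  have hproj (i : Fin 4) : (∅ : Set ℚ_[p]).DefinableFun Language.ring fun v => v i := .proj _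
  have hzero (i : Fin 4) : (∅ : Set ℚ_[p]).Definable Language.ring {v | v i = 0} :=
    (hproj i).ofPred_eq FirstOrder.Ring.definableFun_zero
  have hu := Padic.definableFun_unglue (hproj 0) (hproj 1)
  have hr := Padic.definableFun_restoreAxis hu.1 hu.2
  convert! (((Padic.definable_norm_le_one (hproj 0)).inter
    (Padic.definable_norm_le_one (hproj 1))).sdiff ((hzero 0).inter (hzero 1))).inter
      ((hr.1.ofPred_eq (hproj 2)).inter (hr.2.ofPred_eq (hproj 3))) using 1
  ext v
  simp [Prod.ext_iff]
end

section
/- For every prime p, there exists a bijection from ℤ_p onto ℤ_p∖{0} whose graph, viewed as a subset of ℚ_p² (encoded as Set (Fin 2 → ℚ_p)), is ∅-definable in the first-order language of rings. -/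
open FirstOrder

namespace PadicInt

open Nat (totient)

variable {p : ℕ} [Fact p.Prime]

theorem norm_totient_add_one : ‖((totient (p ^ 2) + 1 : ℕ) : ℤ_[p])‖ = 1 := by
  rw [norm_natCast_eq_one_iff, Nat.totient_prime_pow Fact.out two_pos]
  simp

theorem existsUnique_pow_eq_near_one {n : ℕ} (hn : ‖(n : ℤ_[p])‖ = 1) {c : ℤ_[p]}
    (hc : ‖c - 1‖ < 1) : ∃! y : ℤ_[p], y ^ n = c ∧ ‖y - 1‖ < 1 := by
  let F : Polynomial ℤ_[p] := Polynomial.X ^ n - Polynomial.C c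
  have hF (y : ℤ_[p]) : F.aeval y = y ^ n - c := by simp [F]
  have hF' : F.derivative.aeval (1 : ℤ_[p]) = n := by
    simp [F, Polynomial.derivative_X_pow]
  have hnorm : ‖F.aeval (1 : ℤ_[p])‖ < ‖F.derivative.aeval (1 : ℤ_[p])‖ ^ 2 := by
    rw [hF, hF', hn, one_pow, one_pow, norm_sub_rev]
    exact hc
  obtain ⟨y, hy, hy1, -, huniq⟩ := hensels_lemma hnorm
  simp only [hF, hF', hn, sub_eq_zero] at hy hy1 huniq
  exact ⟨y, ⟨hy, hy1⟩, fun z hz => huniq z hz.1 hz.2⟩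

theorem toZModPow_eq_one_iff {x : ℤ_[p]} {k : ℕ} :
    toZModPow k x = 1 ↔ ∃ t, x = 1 + (p : ℤ_[p]) ^ k * t := by
  rw [← sub_eq_zero, ← map_one (toZModPow k), ← map_sub, ← RingHom.mem_ker, ker_toZModPow,
    Ideal.mem_span_singleton]
  simp only [dvd_def, sub_eq_iff_eq_add']

theorem norm_p_mul_lt_one (t : ℤ_[p]) : ‖(p : ℤ_[p]) * t‖ < 1 := by
  rw [norm_lt_one_iff_dvd]
  exact dvd_mul_right _ _

theorem bijective_units_pow :
    Function.Bijective fun u : ℤ_[p]ˣ => u ^ (totient (p ^ 2) + 1) := by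
  have near {v : ℤ_[p]ˣ} (hv : Units.map (toZModPow (p := p) 2).toMonoidHom v = 1) :
      ‖(v : ℤ_[p]) - 1‖ < 1 := by
    obtain ⟨t, ht⟩ := toZModPow_eq_one_iff.1 (congrArg Units.val hv)
    rw [ht, add_sub_cancel_left, pow_two, mul_assoc]
    exact norm_p_mul_lt_one _
  constructor
  · intro u w huw
    have h1 : (u / w) ^ (totient (p ^ 2) + 1) = 1 := by
      rw [div_pow]
      exact div_eq_one.2 huw
    have h2 : Units.map (toZModPow (p := p) 2).toMonoidHom (u / w) = 1 := by
      have := congrArg (Units.map (toZModPow (p := p) 2).toMonoidHom) h1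
      rwa [map_pow, pow_succ _ (totient (p ^ 2)), ZMod.pow_totient, one_mul, map_one] at this
    have h3 := (existsUnique_pow_eq_near_one (norm_totient_add_one (p := p))
      (c := 1) (by simp)).unique ⟨congrArg Units.val h1, near h2⟩
      ⟨one_pow _, by rw [sub_self, norm_zero]; exact one_pos⟩
    exact div_eq_one.1 (Units.ext h3)
  · intro c
    have h1 : Units.map (toZModPow (p := p) 2).toMonoidHom (c ^ totient (p ^ 2)) = 1 := by
      rw [map_pow, ZMod.pow_totient]
    obtain ⟨w, ⟨hw, -⟩, -⟩ := existsUnique_pow_eq_near_one (norm_totient_add_one (p := p)) (near h1)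
    have hwu : IsUnit w := by
      rw [← isUnit_pow_iff (Nat.succ_ne_zero (totient (p ^ 2))), hw]
      exact Units.isUnit _
    obtain ⟨w, rfl⟩ := hwu
    have hw' : w ^ (totient (p ^ 2) + 1) = c ^ totient (p ^ 2) := Units.ext hw
    refine ⟨c / w, ?_⟩
    simp only [div_pow, hw']
    rw [pow_succ _ (totient (p ^ 2)), mul_div_cancel_left]

/-- The angular component modulo `p ^ 2`, with the junk value `1` at `0`. -/
noncomputable def angularComponent (x : ℤ_[p]) : (ZMod (p ^ 2))ˣ :=
  open Classical in
  if h : x ≠ 0 then Units.map (toZModPow (p := p) 2).toMonoidHom (unitCoeff h) else 1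

theorem exists_eq_pow_mul_unit {x : ℤ_[p]} (hx : x ≠ 0) :
    ∃ u : ℤ_[p]ˣ, x = (p : ℤ_[p]) ^ x.valuation * u :=
  ⟨unitCoeff hx, by rw [mul_comm]; exact unitCoeff_spec hx⟩

theorem p_pow_ne_zero (k : ℕ) : (p : ℤ_[p]) ^ k ≠ 0 :=
  pow_ne_zero _ (NeZero.ne _)

theorem valuation_units (u : ℤ_[p]ˣ) : (u : ℤ_[p]).valuation = 0 := by
  have h := valuation_mul (p := p) u.ne_zero u⁻¹.ne_zero
  rw [Units.mul_inv, valuation_one] at h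
  omega

theorem valuation_pow_mul_unit (k : ℕ) (u : ℤ_[p]ˣ) :
    ((p : ℤ_[p]) ^ k * u).valuation = k := by
  rw [valuation_p_pow_mul _ _ u.ne_zero, valuation_units, add_zero]

theorem angularComponent_pow_mul_unit (k : ℕ) (u : ℤ_[p]ˣ) :
    angularComponent ((p : ℤ_[p]) ^ k * (u : ℤ_[p])) =
      Units.map (toZModPow (p := p) 2).toMonoidHom u := by
  have h : (p : ℤ_[p]) ^ k * (u : ℤ_[p]) ≠ 0 := mul_ne_zero (p_pow_ne_zero k) u.ne_zero
  rw [angularComponent, dif_pos h]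
  congr 1
  have h2 := unitCoeff_spec h
  rw [valuation_pow_mul_unit] at h2
  exact (Units.ext (mul_right_cancel₀ (p_pow_ne_zero k) ((mul_comm _ _).trans h2))).symm

theorem angularComponent_mul {x y : ℤ_[p]} (hx : x ≠ 0) (hy : y ≠ 0) :
    angularComponent (x * y) = angularComponent x * angularComponent y := by
  obtain ⟨u, hu⟩ := exists_eq_pow_mul_unit hx
  obtain ⟨w, hw⟩ := exists_eq_pow_mul_unit hy
  have h : x * y = (p : ℤ_[p]) ^ (x.valuation + y.valuation) * (u * w : ℤ_[p]ˣ) := by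
    nth_rw 1 [hu, hw]
    push_cast
    ring
  rw [h, hu, hw]
  simp only [angularComponent_pow_mul_unit, map_mul]

theorem angularComponent_pow_p (k : ℕ) : angularComponent ((p : ℤ_[p]) ^ k) = 1 := by
  simpa using angularComponent_pow_mul_unit (p := p) k 1

theorem angularComponent_pow {x : ℤ_[p]} (hx : x ≠ 0) (k : ℕ) :
    angularComponent (x ^ k) = angularComponent x ^ k := by
  induction k with
  | zero => simpa using angularComponent_pow_p (p := p) 0
  | succ k ih => rw [pow_succ _ k, angularComponent_mul (pow_ne_zero _ hx) hx, ih, pow_succ _ k]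

theorem angularComponent_pow_totient_add_one {x : ℤ_[p]} (hx : x ≠ 0) :
    angularComponent (x ^ (totient (p ^ 2) + 1)) = angularComponent x := by
  rw [angularComponent_pow hx, pow_succ _ (totient (p ^ 2)), ZMod.pow_totient, one_mul]

theorem one_add_sq_mul_ne_zero (t : ℤ_[p]) : 1 + (p : ℤ_[p]) ^ 2 * t ≠ 0 := by
  intro h
  have h1 := norm_p_mul_lt_one ((p : ℤ_[p]) * t)
  rw [← mul_assoc, ← pow_two, ← neg_eq_of_add_eq_zero_right h] at h1
  simp at h1

theorem valuation_eq_zero_and_angularComponent_eq_one_iff {x : ℤ_[p]} (hx : x ≠ 0) :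
    x.valuation = 0 ∧ angularComponent x = 1 ↔ ∃ t, x = 1 + (p : ℤ_[p]) ^ 2 * t := by
  constructor
  · rintro ⟨h0, h1⟩
    obtain ⟨u, hu⟩ := exists_eq_pow_mul_unit hx
    rw [hu, angularComponent_pow_mul_unit] at h1
    rw [h0, pow_zero, one_mul] at hu
    rw [hu]
    exact toZModPow_eq_one_iff.1 (congrArg Units.val h1 :)
  · rintro ⟨t, ht⟩
    have hu : IsUnit x := by
      rw [isUnit_iff, ht, norm_add_eq_max_of_ne]
      · have := norm_p_mul_lt_one ((p : ℤ_[p]) * t)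
        rw [← mul_assoc, ← pow_two] at this
        rw [norm_one, max_eq_left this.le]
      · have := norm_p_mul_lt_one ((p : ℤ_[p]) * t)
        rw [← mul_assoc, ← pow_two] at this
        rw [norm_one]
        exact this.ne'
    obtain ⟨u, rfl⟩ := hu
    refine ⟨valuation_units u, ?_⟩
    have := angularComponent_pow_mul_unit (p := p) 0 u
    rw [pow_zero, one_mul] at this
    rw [this]
    exact Units.ext (toZModPow_eq_one_iff.2 ⟨t, ht⟩)

theorem angularComponent_eq_one_iff {x : ℤ_[p]} : x ≠ 0 ∧ angularComponent x = 1 ↔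
    x ≠ 0 ∧ ∃ (i : Fin (totient (p ^ 2))) (y t : ℤ_[p]),
      x = (p : ℤ_[p]) ^ (i : ℕ) * y ^ totient (p ^ 2) * (1 + (p : ℤ_[p]) ^ 2 * t) := by
  have hpos : 0 < totient (p ^ 2) := Nat.totient_pos.2 (pow_pos (Fact.out : p.Prime).pos 2)
  refine and_congr_right fun hx => ⟨fun h => ?_, ?_⟩
  · obtain ⟨u, hu⟩ := exists_eq_pow_mul_unit hx
    rw [hu, angularComponent_pow_mul_unit] at h
    obtain ⟨t, ht⟩ := toZModPow_eq_one_iff.1 (congrArg Units.val h :)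
    refine ⟨⟨x.valuation % totient (p ^ 2), Nat.mod_lt _ hpos⟩,
      (p : ℤ_[p]) ^ (x.valuation / totient (p ^ 2)), t, ?_⟩
    rw [← ht, ← pow_mul, ← pow_add, mul_comm (_ / _), Nat.mod_add_div]
    exact hu
  · rintro ⟨i, y, t, h⟩
    have hy : y ^ totient (p ^ 2) ≠ 0 := by
      intro h0
      simp [h, h0] at hx
    have hy0 : y ≠ 0 := by
      rintro rfl
      exact hy (zero_pow hpos.ne')
    have ht := one_add_sq_mul_ne_zero t
    rw [h, angularComponent_mul (mul_ne_zero (p_pow_ne_zero _) hy) ht,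
      angularComponent_mul (p_pow_ne_zero _) hy, angularComponent_pow_p, angularComponent_pow hy0,
      ZMod.pow_totient, ((valuation_eq_zero_and_angularComponent_eq_one_iff ht).2 ⟨t, rfl⟩).2]
    simp

theorem exists_pow_eq {z : ℤ_[p]} (hz : z ≠ 0) (hv : totient (p ^ 2) + 1 ∣ z.valuation) :
    ∃ y ≠ 0, y ^ (totient (p ^ 2) + 1) = z := by
  obtain ⟨u, hu⟩ := exists_eq_pow_mul_unit hz
  obtain ⟨q, hq⟩ := hv
  obtain ⟨w, hw⟩ := bijective_units_pow.2 u
  refine ⟨(p : ℤ_[p]) ^ q * w, mul_ne_zero (p_pow_ne_zero q) w.ne_zero, ?_⟩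
  rw [hu, hq, ← hw, mul_pow, ← pow_mul, mul_comm q, Units.val_pow_eq_pow_val]

theorem pow_injective {y z : ℤ_[p]} (hy : y ≠ 0) (hz : z ≠ 0)
    (h : y ^ (totient (p ^ 2) + 1) = z ^ (totient (p ^ 2) + 1)) : y = z := by
  obtain ⟨u, hu⟩ := exists_eq_pow_mul_unit hy
  obtain ⟨w, hw⟩ := exists_eq_pow_mul_unit hz
  have hv := congrArg valuation h
  rw [valuation_pow, valuation_pow] at hv
  have hv' := Nat.eq_of_mul_eq_mul_left (Nat.succ_pos _) hv
  rw [hu, hw, hv', mul_pow, mul_pow] at h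
  have h2 := mul_left_cancel₀ (pow_ne_zero _ (p_pow_ne_zero _)) h
  have h3 : u = w := bijective_units_pow.1 (Units.ext h2)
  rw [hu, hw, hv', h3]

theorem isUnit_val (j : (ZMod (p ^ 2))ˣ) : IsUnit (((j : ZMod (p ^ 2)).val : ℕ) : ℤ_[p]) := by
  rw [isUnit_iff, norm_natCast_eq_one_iff]
  exact ((ZMod.val_coe_unit_coprime j).coprime_dvd_right (dvd_pow_self p two_ne_zero)).symm

theorem val_ne_zero (j : (ZMod (p ^ 2))ˣ) : (((j : ZMod (p ^ 2)).val : ℕ) : ℤ_[p]) ≠ 0 :=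
  (isUnit_val j).ne_zero

theorem valuation_val (j : (ZMod (p ^ 2))ˣ) :
    (((j : ZMod (p ^ 2)).val : ℕ) : ℤ_[p]).valuation = 0 := by
  obtain ⟨u, hu⟩ := isUnit_val j
  rw [← hu, valuation_units]

theorem angularComponent_val (j : (ZMod (p ^ 2))ˣ) :
    angularComponent (((j : ZMod (p ^ 2)).val : ℕ) : ℤ_[p]) = j := by
  obtain ⟨u, hu⟩ := isUnit_val j
  have := angularComponent_pow_mul_unit (p := p) 0 u
  rw [pow_zero, one_mul] at this
  rw [← hu, this]
  ext
  simp [hu]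

/-- An enumeration of the residue classes modulo `p ^ 2` prime to `p`. -/
noncomputable def unitsEquivFin : (ZMod (p ^ 2))ˣ ≃ Fin (totient (p ^ 2)) :=
  Fintype.equivFinOfCardEq (ZMod.card_units_eq_totient _)

/-- The graph of a bijection from `ℤ_[p] \ {0}` onto `ℤ_[p]`. It is the identity on the elements of
angular component `≠ 1`. The elements of angular component `1` are moved as follows: `1` is sent to
`0`; those of positive valuation are sent by `p * y ↦ y ^ n`, where `n = φ (p ^ 2) + 1`; and
`1 + p ^ 2 * y` with `y ≠ 0` is sent to `p ^ i * y ^ n / j`, where `j` is the angular component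
of `y` and `i` is a residue `≠ 0` modulo `n` encoding `j`. -/
def ShiftGraph (x z : ℤ_[p]) : Prop :=
  x ≠ 0 ∧
    ((¬(x ≠ 0 ∧ angularComponent x = 1) ∧ z = x) ∨ (x = 1 ∧ z = 0) ∨
    (∃ y, (y ≠ 0 ∧ angularComponent y = 1) ∧ x = (p : ℤ_[p]) * y ∧
      z = y ^ (totient (p ^ 2) + 1)) ∨
    (∃ y, y ≠ 0 ∧ x = 1 + (p : ℤ_[p]) ^ 2 * y ∧ (z ≠ 0 ∧ angularComponent z = 1) ∧
      ∃ j : (ZMod (p ^ 2))ˣ, (((j : ZMod (p ^ 2)).val : ℕ) : ℤ_[p]) * z =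
        (p : ℤ_[p]) ^ ((unitsEquivFin j : ℕ) + 1) * y ^ (totient (p ^ 2) + 1)))

theorem angularComponent_p_mul {y : ℤ_[p]} (hy : y ≠ 0) :
    angularComponent ((p : ℤ_[p]) * y) = angularComponent y := by
  have h := angularComponent_mul (p_pow_ne_zero (p := p) 1) hy
  rwa [angularComponent_pow_p, one_mul, pow_one] at h

theorem valuation_p_mul {y : ℤ_[p]} (hy : y ≠ 0) :
    ((p : ℤ_[p]) * y).valuation = 1 + y.valuation := by
  simpa using valuation_p_pow_mul 1 y hy

theorem valuation_one_add_sq_mul (y : ℤ_[p]) : (1 + (p : ℤ_[p]) ^ 2 * y).valuation = 0 :=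
  ((valuation_eq_zero_and_angularComponent_eq_one_iff (one_add_sq_mul_ne_zero y)).2 ⟨y, rfl⟩).1

theorem angularComponent_one_add_sq_mul (y : ℤ_[p]) :
    angularComponent (1 + (p : ℤ_[p]) ^ 2 * y) = 1 :=
  ((valuation_eq_zero_and_angularComponent_eq_one_iff (one_add_sq_mul_ne_zero y)).2 ⟨y, rfl⟩).2

theorem eq_of_one_eq_one_add {y : ℤ_[p]} (h : 1 = 1 + (p : ℤ_[p]) ^ 2 * y) : y = 0 := by
  simpa [NeZero.ne] using h

section ValMul

variable {j : (ZMod (p ^ 2))ˣ} {y z : ℤ_[p]} {i : ℕ}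

theorem angularComponent_of_val_mul_eq (hy : y ≠ 0) (hz : z ≠ 0 ∧ angularComponent z = 1)
    (h : (((j : ZMod (p ^ 2)).val : ℕ) : ℤ_[p]) * z =
      (p : ℤ_[p]) ^ i * y ^ (totient (p ^ 2) + 1)) : angularComponent y = j := by
  have h1 := congrArg angularComponent h
  rw [angularComponent_mul (val_ne_zero j) hz.1, hz.2, mul_one, angularComponent_val,
    angularComponent_mul (p_pow_ne_zero i) (pow_ne_zero _ hy), angularComponent_pow_p, one_mul,
    angularComponent_pow_totient_add_one hy] at h1
  exact h1.symm

theorem valuation_of_val_mul_eq (hy : y ≠ 0) (hz : z ≠ 0)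
    (h : (((j : ZMod (p ^ 2)).val : ℕ) : ℤ_[p]) * z =
      (p : ℤ_[p]) ^ i * y ^ (totient (p ^ 2) + 1)) :
    z.valuation = i + (totient (p ^ 2) + 1) * y.valuation := by
  have h1 := congrArg valuation h
  rwa [valuation_mul (val_ne_zero j) hz, valuation_val, zero_add,
    valuation_p_pow_mul _ _ (pow_ne_zero _ hy), valuation_pow] at h1

end ValMul

theorem exists_shiftGraph_right {x : ℤ_[p]} (hx : x ≠ 0) : ∃ z, ShiftGraph x z := by
  by_cases hU : angularComponent x = 1
  swap
  · exact ⟨x, hx, .inl ⟨fun h => hU h.2, rfl⟩⟩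
  by_cases hv : x.valuation = 0
  · obtain ⟨y, rfl⟩ := (valuation_eq_zero_and_angularComponent_eq_one_iff hx).1 ⟨hv, hU⟩
    by_cases hy : y = 0
    · exact ⟨0, hx, .inr (.inl ⟨by rw [hy, mul_zero, add_zero], rfl⟩)⟩
    · obtain ⟨u, hu⟩ := isUnit_val (angularComponent y)
      set i := (unitsEquivFin (angularComponent y) : ℕ) + 1 with hi
      set w := (p : ℤ_[p]) ^ i * y ^ (totient (p ^ 2) + 1) with hw
      have hw0 : w ≠ 0 := mul_ne_zero (p_pow_ne_zero _) (pow_ne_zero _ hy)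
      have hwz : (((angularComponent y : ZMod (p ^ 2)).val : ℕ) : ℤ_[p]) *
          ((u⁻¹ : ℤ_[p]ˣ) * w) = w := by
        rw [← hu, Units.mul_inv_cancel_left]
      have hz0 : (u⁻¹ : ℤ_[p]ˣ) * w ≠ 0 := mul_ne_zero (Units.ne_zero _) hw0
      refine ⟨(u⁻¹ : ℤ_[p]ˣ) * w, hx, .inr (.inr (.inr ⟨y, hy, rfl, ⟨hz0, ?_⟩, _, hwz⟩))⟩
      have h1 := congrArg angularComponent hwz
      rw [angularComponent_mul (val_ne_zero _) hz0, angularComponent_val, hw,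
        angularComponent_mul (p_pow_ne_zero i) (pow_ne_zero _ hy), angularComponent_pow_p, one_mul,
        angularComponent_pow_totient_add_one hy, ← hw] at h1
      exact mul_eq_left.1 h1
  · obtain ⟨u, hu⟩ := exists_eq_pow_mul_unit hx
    obtain ⟨k, hk⟩ := Nat.exists_eq_succ_of_ne_zero hv
    have hxy : x = p * ((p : ℤ_[p]) ^ k * (u : ℤ_[p])) := by
      rw [← mul_assoc, ← pow_succ', ← Nat.succ_eq_add_one, ← hk]
      exact hu
    have hy : (p : ℤ_[p]) ^ k * (u : ℤ_[p]) ≠ 0 := mul_ne_zero (p_pow_ne_zero _) u.ne_zero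
    refine ⟨_, hx, .inr (.inr (.inl ⟨_, ⟨hy, ?_⟩, hxy, rfl⟩))⟩
    rw [← angularComponent_p_mul hy, ← hxy, hU]

theorem ShiftGraph.right_unique {x z z' : ℤ_[p]} (h : ShiftGraph x z) (h' : ShiftGraph x z') :
    z = z' := by
  obtain ⟨hx, h⟩ := h
  obtain ⟨-, h'⟩ := h'
  have hone : angularComponent (1 : ℤ_[p]) = 1 := by simpa using angularComponent_pow_p (p := p) 0
  have hp0 : (p : ℤ_[p]) ≠ 0 := NeZero.ne _
  rcases h with ⟨hU, rfl⟩ | ⟨rfl, rfl⟩ | ⟨y, hy, rfl, rfl⟩ | ⟨y, hy, rfl, hz, j, hj⟩ <;>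
  rcases h' with ⟨hU', hz'⟩ | ⟨hx', rfl⟩ | ⟨y', hy', hx', rfl⟩ | ⟨y', hy', hx', hz', j', hj'⟩
  · exact hz'.symm
  · exact absurd ⟨hx, hx' ▸ hone⟩ hU
  · exact absurd ⟨hx, by rw [hx', angularComponent_p_mul hy'.1, hy'.2]⟩ hU
  · exact absurd ⟨hx, by rw [hx', angularComponent_one_add_sq_mul]⟩ hU
  · exact absurd ⟨hx, hone⟩ hU'
  · rfl
  · have := congrArg valuation hx'
    rw [valuation_one, valuation_p_mul hy'.1] at this
    omega
  · exact absurd (eq_of_one_eq_one_add hx') hy'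
  · exact absurd ⟨hx, by rw [angularComponent_p_mul hy.1, hy.2]⟩ hU'
  · have := congrArg valuation hx'
    rw [valuation_one, valuation_p_mul hy.1] at this
    omega
  · rw [mul_left_cancel₀ hp0 hx']
  · have := congrArg valuation hx'
    rw [valuation_one_add_sq_mul, valuation_p_mul hy.1] at this
    omega
  · exact absurd ⟨hx, angularComponent_one_add_sq_mul y⟩ hU'
  · exact absurd (eq_of_one_eq_one_add hx'.symm) hy
  · have := congrArg valuation hx'
    rw [valuation_one_add_sq_mul, valuation_p_mul hy'.1] at this
    omega
  · obtain rfl : y = y' := mul_left_cancel₀ (p_pow_ne_zero 2) (add_left_cancel hx')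
    obtain rfl := angularComponent_of_val_mul_eq hy hz hj
    obtain rfl := angularComponent_of_val_mul_eq hy hz' hj'
    exact mul_left_cancel₀ (val_ne_zero _) (hj.trans hj'.symm)

theorem exists_shiftGraph_left (z : ℤ_[p]) : ∃ x, ShiftGraph x z := by
  by_cases hz : z = 0
  · exact ⟨1, one_ne_zero, .inr (.inl ⟨rfl, hz⟩)⟩
  by_cases hU : angularComponent z = 1
  swap
  · exact ⟨z, hz, .inl ⟨fun h => hU h.2, rfl⟩⟩
  by_cases hr : z.valuation % (totient (p ^ 2) + 1) = 0
  · obtain ⟨y, hy, rfl⟩ := exists_pow_eq hz (Nat.dvd_of_mod_eq_zero hr)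
    rw [angularComponent_pow_totient_add_one hy] at hU
    exact ⟨p * y, mul_ne_zero (NeZero.ne _) hy, .inr (.inr (.inl ⟨y, ⟨hy, hU⟩, rfl, rfl⟩))⟩
  · have hlt := Nat.mod_lt z.valuation (Nat.succ_pos (totient (p ^ 2)))
    obtain ⟨i, hi⟩ := Nat.exists_eq_add_one_of_ne_zero hr
    obtain ⟨j, hj⟩ := (unitsEquivFin (p := p)).surjective ⟨i, by rw [hi] at hlt; omega⟩
    obtain ⟨u, hu⟩ := exists_eq_pow_mul_unit hz
    have hc : (((j : ZMod (p ^ 2)).val : ℕ) : ℤ_[p]) * (p : ℤ_[p]) ^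
        ((totient (p ^ 2) + 1) * (z.valuation / (totient (p ^ 2) + 1))) * (u : ℤ_[p]) ≠ 0 :=
      mul_ne_zero (mul_ne_zero (val_ne_zero j) (p_pow_ne_zero _)) u.ne_zero
    obtain ⟨y, hy, hyc⟩ := exists_pow_eq hc (by
      rw [mul_assoc, valuation_mul (val_ne_zero j) (mul_ne_zero (p_pow_ne_zero _) u.ne_zero),
        valuation_val, valuation_pow_mul_unit, zero_add]
      exact dvd_mul_right _ _)
    refine ⟨1 + (p : ℤ_[p]) ^ 2 * y, one_add_sq_mul_ne_zero y,
      .inr (.inr (.inr ⟨y, hy, rfl, ⟨hz, hU⟩, j, ?_⟩))⟩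
    have hdiv := Nat.mod_add_div z.valuation (totient (p ^ 2) + 1)
    rw [hyc, hj]
    conv_lhs => rw [hu, ← hdiv, hi, pow_add]
    ring

theorem ShiftGraph.left_unique {x x' z : ℤ_[p]} (h : ShiftGraph x z) (h' : ShiftGraph x' z) :
    x = x' := by
  obtain ⟨hx, h⟩ := h
  obtain ⟨hx', h'⟩ := h'
  have powU {y : ℤ_[p]} (hy : y ≠ 0 ∧ angularComponent y = 1) :
      y ^ (totient (p ^ 2) + 1) ≠ 0 ∧ angularComponent (y ^ (totient (p ^ 2) + 1)) = 1 :=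
    ⟨pow_ne_zero _ hy.1, by rw [angularComponent_pow_totient_add_one hy.1, hy.2]⟩
  have key {y z : ℤ_[p]} {j : (ZMod (p ^ 2))ˣ} (hy : y ≠ 0) (hz : z ≠ 0)
      (hj : (((j : ZMod (p ^ 2)).val : ℕ) : ℤ_[p]) * z =
        (p : ℤ_[p]) ^ ((unitsEquivFin j : ℕ) + 1) * y ^ (totient (p ^ 2) + 1)) :
      z.valuation % (totient (p ^ 2) + 1) = (unitsEquivFin j : ℕ) + 1 := by
    rw [valuation_of_val_mul_eq hy hz hj, Nat.add_mul_mod_self_left]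
    exact Nat.mod_eq_of_lt (Nat.succ_lt_succ (unitsEquivFin j).2)
  rcases h with ⟨hU, rfl⟩ | ⟨rfl, rfl⟩ | ⟨y, hy, rfl, rfl⟩ | ⟨y, hy, rfl, hz, j, hj⟩ <;>
  rcases h' with ⟨hU', hz'⟩ | ⟨hx', hz'⟩ | ⟨y', hy', hx', hz'⟩ | ⟨y', hy', rfl, hz', j', hj'⟩
  · exact hz'
  · exact absurd hz' hx
  · exact absurd (hz' ▸ powU hy') hU
  · exact absurd hz' hU
  · exact absurd hz'.symm hx'
  · exact hx'.symm
  · exact absurd hz'.symm (powU hy').1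
  · exact absurd rfl hz'.1
  · exact absurd (hz' ▸ powU hy) hU'
  · exact absurd hz' (powU hy).1
  · rw [hx', pow_injective hy.1 hy'.1 hz']
  · have := key hy' hz'.1 hj'
    simp [valuation_pow] at this
  · exact absurd (hz' ▸ hz) hU'
  · exact absurd hz' hz.1
  · have := key hy hz.1 hj
    simp [hz', valuation_pow] at this
  · have h1 := key hy hz.1 hj
    have h2 := key hy' hz.1 hj'
    obtain rfl : j = j' := unitsEquivFin.injective (Fin.ext (by omega))
    rw [pow_injective hy hy' (mul_left_cancel₀ (p_pow_ne_zero _) (hj.symm.trans hj'))]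

section Definability

open FreeCommRing FirstOrder.Ring

variable {α : Type*}

theorem definable_lift_eq (q r : FreeCommRing α) :
    Set.Definable (∅ : Set ℚ_[p]) Language.ring
      {v : α → ℚ_[p] | FreeCommRing.lift v q = FreeCommRing.lift v r} := by
  simp only [← realize_termOfFreeCommRing]
  exact (Language.Term.definableFun_realize _).ofPred_eq (Language.Term.definableFun_realize _)

theorem norm_le_one_iff_exists_pow_eq (x : ℚ_[p]) : ‖x‖ ≤ 1 ↔
    ∃ y : ℚ_[p], y ^ (totient (p ^ 2) + 1) = 1 + p * x ^ (totient (p ^ 2) + 1) := by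
  have hp := (Fact.out : p.Prime)
  have h2 : 2 ≤ totient (p ^ 2) := by
    rw [Nat.totient_prime_pow hp two_pos]
    exact hp.two_le.trans (by simpa using Nat.le_mul_of_pos_right p (Nat.sub_pos_of_lt hp.one_lt))
  set n := totient (p ^ 2) + 1 with hn
  constructor
  · intro hx
    obtain ⟨x, rfl⟩ : ∃ y : ℤ_[p], (y : ℚ_[p]) = x := ⟨⟨x, hx⟩, rfl⟩
    obtain ⟨y, ⟨hy, -⟩, -⟩ := existsUnique_pow_eq_near_one (norm_totient_add_one (p := p))
      (c := 1 + (p : ℤ_[p]) * x ^ n) (by rw [add_sub_cancel_left]; exact norm_p_mul_lt_one _)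
    exact ⟨y, by exact_mod_cast congrArg ((↑) : ℤ_[p] → ℚ_[p]) hy⟩
  · rintro ⟨y, hy⟩
    by_contra! hx
    have hp0 : (p : ℚ_[p]) ≠ 0 := NeZero.ne _
    have hx0 : x ≠ 0 := by
      rintro rfl
      simp at hx
      linarith
    have hxv : x.valuation < 0 := by
      by_contra! h
      exact hx.not_ge ((Padic.norm_le_one_iff_val_nonneg x).2 h)
    have hw0 : (p : ℚ_[p]) * x ^ n ≠ 0 := mul_ne_zero hp0 (pow_ne_zero _ hx0)
    have hwv : ((p : ℚ_[p]) * x ^ n).valuation = 1 + n * x.valuation := by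
      rw [Padic.valuation_mul hp0 (pow_ne_zero _ hx0), Padic.valuation_p, Padic.valuation_pow]
    have hneg : 1 + n * x.valuation < 0 := by
      have : (3 : ℤ) ≤ n := by omega
      nlinarith
    have hw1 : 1 < ‖(p : ℚ_[p]) * x ^ n‖ := by
      by_contra! h
      have := (Padic.norm_le_one_iff_val_nonneg _).1 h
      omega
    have hnorm : ‖y ^ n‖ = ‖(p : ℚ_[p]) * x ^ n‖ := by
      rw [hy, Padic.add_eq_max_of_ne (by rw [norm_one]; exact hw1.ne), norm_one,
        max_eq_right hw1.le]
    have hy0 : y ^ n ≠ 0 := by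
      rw [← norm_ne_zero_iff, hnorm, norm_ne_zero_iff]
      exact hw0
    rw [Padic.norm_eq_zpow_neg_valuation hy0, Padic.norm_eq_zpow_neg_valuation hw0] at hnorm
    have hval := zpow_right_injective₀ (by exact_mod_cast hp.pos) (by exact_mod_cast hp.one_lt.ne')
      hnorm
    rw [neg_inj, hwv, Padic.valuation_pow] at hval
    have hdvd : (n : ℤ) ∣ 1 := ⟨y.valuation - x.valuation, by linarith⟩
    have := Int.le_of_dvd one_pos hdvd
    omega

theorem definable_norm_le_one (i : α) :
    Set.Definable (∅ : Set ℚ_[p]) Language.ring {v : α → ℚ_[p] | ‖v i‖ ≤ 1} := by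
  have h := (definable_lift_eq (p := p) (of (Sum.inr ()) ^ (totient (p ^ 2) + 1))
    (1 + (p : FreeCommRing (α ⊕ Unit)) *
      of (Sum.inl i) ^ (totient (p ^ 2) + 1))).exists_of_finite
  convert h using 1
  ext v
  simp only [Set.mem_ofPred_eq, norm_le_one_iff_exists_pow_eq]
  exact ⟨fun ⟨y, hy⟩ => ⟨fun _ => y, by simpa using hy⟩, fun ⟨u, hu⟩ => ⟨u (), by simpa using hu⟩⟩

/-- A relation between `p`-adic integers is definable if it is definable as a relation between
`p`-adic numbers. -/
def DefinableRel (P : (α → ℤ_[p]) → Prop) : Prop :=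
  Set.Definable (∅ : Set ℚ_[p]) Language.ring
    {v : α → ℚ_[p] | ∃ w : α → ℤ_[p], v = (fun i => (w i : ℚ_[p])) ∧ P w}

theorem coe_comp_injective :
    Function.Injective fun (w : α → ℤ_[p]) i => (w i : ℚ_[p]) :=
  fun _ _ h => funext fun i => PadicInt.ext (congrFun h i)

namespace DefinableRel

variable {P Q : (α → ℤ_[p]) → Prop}

theorem congr (h : DefinableRel P) (hPQ : ∀ w, P w ↔ Q w) : DefinableRel Q := by
  rwa [← show P = Q from funext fun w => propext (hPQ w)]

theorem true [Finite α] : DefinableRel fun _ : α → ℤ_[p] => True := by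
  have h := Set.definable_iInter_of_finite fun i : α => definable_norm_le_one (p := p) i
  refine (congrArg (Set.Definable (∅ : Set ℚ_[p]) Language.ring) ?_).mp
    h
  ext v
  simp only [Set.mem_iInter, Set.mem_ofPred_eq, and_true]
  exact ⟨fun hv => ⟨fun i => ⟨v i, hv i⟩, rfl⟩, by rintro ⟨w, rfl⟩ i; exact (w i).2⟩

theorem and (hP : DefinableRel P) (hQ : DefinableRel Q) : DefinableRel fun w => P w ∧ Q w := by
  refine (congrArg (Set.Definable (∅ : Set ℚ_[p]) Language.ring) ?_).mp
    (Set.Definable.inter hP hQ)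
  ext v
  constructor
  · rintro ⟨⟨w, rfl, hw⟩, w', h, hw'⟩
    obtain rfl := coe_comp_injective h
    exact ⟨w, rfl, hw, hw'⟩
  · rintro ⟨w, rfl, hw, hw'⟩
    exact ⟨⟨w, rfl, hw⟩, w, rfl, hw'⟩

theorem or (hP : DefinableRel P) (hQ : DefinableRel Q) : DefinableRel fun w => P w ∨ Q w := by
  refine (congrArg (Set.Definable (∅ : Set ℚ_[p]) Language.ring) ?_).mp
    (Set.Definable.union hP hQ)
  ext v
  constructor
  · rintro (⟨w, rfl, hw⟩ | ⟨w, rfl, hw⟩)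
    exacts [⟨w, rfl, .inl hw⟩, ⟨w, rfl, .inr hw⟩]
  · rintro ⟨w, rfl, hw | hw⟩
    exacts [.inl ⟨w, rfl, hw⟩, .inr ⟨w, rfl, hw⟩]

theorem not [Finite α] (hP : DefinableRel P) : DefinableRel fun w => ¬P w := by
  refine (congrArg (Set.Definable (∅ : Set ℚ_[p]) Language.ring) ?_).mp
    (Set.Definable.sdiff (true (p := p) (α := α)) hP)
  ext v
  constructor
  · rintro ⟨⟨w, rfl, -⟩, hw⟩
    exact ⟨w, rfl, fun h => hw ⟨w, rfl, h⟩⟩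
  · rintro ⟨w, rfl, hw⟩
    refine ⟨⟨w, rfl, trivial⟩, ?_⟩
    rintro ⟨w', h, hw'⟩
    obtain rfl := coe_comp_injective h
    exact hw hw'

theorem exists_finite {ι : Type*} [Finite ι] {P : ι → (α → ℤ_[p]) → Prop}
    (hP : ∀ i, DefinableRel (P i)) : DefinableRel fun w => ∃ i, P i w := by
  refine (congrArg (Set.Definable (∅ : Set ℚ_[p]) Language.ring) ?_).mp
    (Set.definable_iUnion_of_finite
      (f := fun i => {v | ∃ w : α → ℤ_[p], v = (fun i => (w i : ℚ_[p])) ∧ P i w}) hP)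
  ext v
  simp only [Set.mem_iUnion, Set.mem_ofPred_eq]
  exact ⟨fun ⟨i, w, h, hw⟩ => ⟨w, h, i, hw⟩, fun ⟨w, h, i, hw⟩ => ⟨i, w, h, hw⟩⟩

theorem exists_padicInt {P : (α → ℤ_[p]) → ℤ_[p] → Prop}
    (hP : DefinableRel fun w : α ⊕ Unit → ℤ_[p] => P (fun i => w (.inl i)) (w (.inr ()))) :
    DefinableRel fun w => ∃ x, P w x := by
  refine (congrArg (Set.Definable (∅ : Set ℚ_[p]) Language.ring) ?_).mp
    (Set.Definable.exists_of_finite hP)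
  ext v
  constructor
  · rintro ⟨u, w, h, hw⟩
    exact ⟨fun i => w (.inl i), funext fun i => congrFun h (.inl i), _, hw⟩
  · rintro ⟨w, rfl, x, hw⟩
    refine ⟨fun _ => x, Sum.elim w fun _ => x, ?_, hw⟩
    ext (i | i) <;> rfl

theorem lift_eq [Finite α] (q r : FreeCommRing α) :
    DefinableRel fun w : α → ℤ_[p] => FreeCommRing.lift w q = FreeCommRing.lift w r := by
  have key (w : α → ℤ_[p]) (q : FreeCommRing α) :
      FreeCommRing.lift (fun i => (w i : ℚ_[p])) q = (FreeCommRing.lift w q : ℤ_[p]) := by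
    have : FreeCommRing.lift (fun i => (w i : ℚ_[p])) =
        (Coe.ringHom (p := p)).comp (FreeCommRing.lift w) := by
      ext i
      rw [RingHom.comp_apply, FreeCommRing.lift_of, FreeCommRing.lift_of]
      rfl
    rw [this]
    rfl
  refine (congrArg (Set.Definable (∅ : Set ℚ_[p]) Language.ring) ?_).mp
    (Set.Definable.inter (true (p := p) (α := α)) (definable_lift_eq q r))
  ext v
  constructor
  · rintro ⟨⟨w, rfl, -⟩, hw⟩
    refine ⟨w, rfl, PadicInt.ext ?_⟩
    rw [← key, ← key]
    exact hw
  · rintro ⟨w, rfl, hw⟩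
    refine ⟨⟨w, rfl, trivial⟩, ?_⟩
    simp only [Set.mem_ofPred_eq, key, hw]

theorem ne_zero [Finite α] (i : α) : DefinableRel fun w : α → ℤ_[p] => w i ≠ 0 :=
  ((lift_eq (of i) 0).not).congr fun w => by simp

theorem angularComponent_eq_one [Finite α] (i : α) :
    DefinableRel fun w : α → ℤ_[p] => w i ≠ 0 ∧ angularComponent (w i) = 1 := by
  have h (k : Fin (totient (p ^ 2))) : DefinableRel fun w : α → ℤ_[p] => ∃ y t : ℤ_[p],
      w i = (p : ℤ_[p]) ^ (k : ℕ) * y ^ totient (p ^ 2) * (1 + (p : ℤ_[p]) ^ 2 * t) :=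
    exists_padicInt (exists_padicInt
      ((lift_eq (of (.inl (.inl i))) ((p : FreeCommRing ((α ⊕ Unit) ⊕ Unit)) ^ (k : ℕ) *
        of (.inl (.inr ())) ^ totient (p ^ 2) *
        (1 + (p : FreeCommRing ((α ⊕ Unit) ⊕ Unit)) ^ 2 * of (.inr ())))).congr
          fun w => by simp))
  exact ((ne_zero i).and (exists_finite h)).congr fun w => angularComponent_eq_one_iff.symm

theorem shiftGraph : DefinableRel fun w : Fin 2 → ℤ_[p] => ShiftGraph (w 1) (w 0) := by
  refine (ne_zero 1).and (.or ?_ (.or ?_ (.or ?_ ?_)))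
  · exact (angularComponent_eq_one 1).not.and ((lift_eq (of 0) (of 1)).congr fun w => by simp)
  · exact ((lift_eq (of 1) 1).congr fun w => by simp).and
      ((lift_eq (of 0) 0).congr fun w => by simp)
  · refine exists_padicInt (.and (angularComponent_eq_one _) (.and ?_ ?_))
    · exact (lift_eq (of (.inl 1)) ((p : FreeCommRing (Fin 2 ⊕ Unit)) * of (.inr ()))).congr
        fun w => by simp
    · exact (lift_eq (of (.inl 0)) (of (.inr ()) ^ (totient (p ^ 2) + 1))).congr
        fun w => by simp
  · refine exists_padicInt (.and (ne_zero _) (.and ?_ (.and (angularComponent_eq_one _)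
      (exists_finite fun j => ?_))))
    · exact (lift_eq (of (.inl 1)) (1 + (p : FreeCommRing (Fin 2 ⊕ Unit)) ^ 2 * of (.inr ()))).congr
        fun w => by simp
    · exact (lift_eq (((j : ZMod (p ^ 2)).val : FreeCommRing (Fin 2 ⊕ Unit)) * of (.inl 0))
        ((p : FreeCommRing (Fin 2 ⊕ Unit)) ^ ((unitsEquivFin j : ℕ) + 1) *
          of (.inr ()) ^ (totient (p ^ 2) + 1))).congr fun w => by simp [-ZMod.natCast_val]

end DefinableRel

end Definability

end PadicInt

theorem exists_definable_bij_Zp_minus_point (p : ℕ) [Fact p.Prime] :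
    ∃ f : ℚ_[p] → ℚ_[p],
      Set.BijOn f {x : ℚ_[p] | ‖x‖ ≤ 1} ({x : ℚ_[p] | ‖x‖ ≤ 1} \ {0}) ∧
      Set.Definable (∅ : Set ℚ_[p]) Language.ring
        {v : Fin 2 → ℚ_[p] | v 0 ∈ {x : ℚ_[p] | ‖x‖ ≤ 1} ∧ f (v 0) = v 1} := by
  classical
  choose F hF using PadicInt.exists_shiftGraph_left (p := p)
  let f (q : ℚ_[p]) : ℚ_[p] := if h : ‖q‖ ≤ 1 then F ⟨q, h⟩ else 0
  have hf (z : ℤ_[p]) : f z = F z := dif_pos z.2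
  refine ⟨f, ⟨?_, ?_, ?_⟩, ?_⟩
  · intro z hz
    obtain ⟨z, rfl⟩ : ∃ y : ℤ_[p], (y : ℚ_[p]) = z := ⟨⟨z, hz⟩, rfl⟩
    rw [hf]
    exact ⟨(F z).2, fun h => (hF z).1 (PadicInt.ext h)⟩
  · intro z hz z' hz' h
    obtain ⟨z, rfl⟩ : ∃ y : ℤ_[p], (y : ℚ_[p]) = z := ⟨⟨z, hz⟩, rfl⟩
    obtain ⟨z', rfl⟩ : ∃ y : ℤ_[p], (y : ℚ_[p]) = z' := ⟨⟨z', hz'⟩, rfl⟩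
    rw [hf, hf] at h
    have h' : F z = F z' := PadicInt.ext h
    rw [(hF z).right_unique (h' ▸ hF z')]
  · rintro x ⟨hx, hx0⟩
    obtain ⟨x, rfl⟩ : ∃ y : ℤ_[p], (y : ℚ_[p]) = x := ⟨⟨x, hx⟩, rfl⟩
    obtain ⟨z, hz⟩ := PadicInt.exists_shiftGraph_right (x := x) fun h => hx0 (by simp [h])
    exact ⟨z, z.2, by rw [hf, (hF z).left_unique hz]⟩
  · refine (congrArg (Set.Definable (∅ : Set ℚ_[p]) Language.ring) ?_).mp
      (PadicInt.DefinableRel.shiftGraph (p := p))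
    ext v
    constructor
    · rintro ⟨w, rfl, hw⟩
      exact ⟨(w 0).2, by rw [hf, (hF _).left_unique hw]⟩
    · rintro ⟨h0, h1⟩
      refine ⟨![⟨v 0, h0⟩, F ⟨v 0, h0⟩], ?_, hF _⟩
      ext i
      fin_cases i
      · rfl
      · exact h1.symm.trans (hf ⟨v 0, h0⟩)
end

section
/- Let F be a finite field, K = LaurentSeries F the field of formal Laurent series over F, t = single 1 1 ∈ K, and R ⊆ K the image of the power series ring F[[X]] in K. Then there exists a bijection from R onto R∖{0} whose graph, viewed as a subset of K² (encoded as Set (Fin 2 → K)), is definable in the first-order language of rings with parameters from {t}. -/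
open FirstOrder

noncomputable instance (F : Type*) [Field F] :
    FirstOrder.Ring.CompatibleRing (LaurentSeries F) :=
  FirstOrder.Ring.compatibleRingOfRing _

namespace DefinableLaurent

open FirstOrder.Ring Set

section Definability

variable {K : Type*} [Field K] [CompatibleRing K] (A : Set K)

/-- A function `(α → K) → K` that is the interpretation of a term of the language of rings with
parameters from `A`. -/
def IsTerm {α : Type*} (f : (α → K) → K) : Prop :=
  ∃ τ : Language.ring[[A]].Term α, ∀ v, τ.realize v = f v

variable {A}
variable {α β : Type*} {f g : (α → K) → K}

theorem IsTerm.var (i : α) : IsTerm A fun v : α → K => v i := ⟨Language.Term.var i, fun _ => rfl⟩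

theorem IsTerm.const {a : K} (ha : a ∈ A) : IsTerm A fun _ : α → K => a :=
  ⟨(Language.ring.con (⟨a, ha⟩ : A)).term, fun _ => Language.Term.realize_con⟩

theorem IsTerm.of_ringTerm (τ : Language.ring.Term α) {h : α → (β → K) → K}
    (hh : ∀ i, IsTerm A (h i)) : IsTerm A fun v => τ.realize fun i => h i v := by
  choose σ hσ using hh
  refine ⟨(((Language.ring).lhomWithConstants A).onTerm τ).subst σ, fun v => ?_⟩
  simp [hσ]

theorem IsTerm.zero : IsTerm A fun _ : α → K => (0 : K) := by
  simpa using IsTerm.of_ringTerm (A := A) (K := K) (0 : Language.ring.Term Empty)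
    (h := fun i (_ : α → K) => i.elim) (fun i => i.elim)

theorem IsTerm.one : IsTerm A fun _ : α → K => (1 : K) := by
  simpa using IsTerm.of_ringTerm (A := A) (K := K) (1 : Language.ring.Term Empty)
    (h := fun i (_ : α → K) => i.elim) (fun i => i.elim)

theorem IsTerm.add (hf : IsTerm A f) (hg : IsTerm A g) : IsTerm A fun v => f v + g v := by
  simpa using IsTerm.of_ringTerm (.var 0 + .var 1 : Language.ring.Term (Fin 2))
    (A := A) (h := ![f, g]) (by simp [Fin.forall_fin_two, hf, hg])

theorem IsTerm.mul (hf : IsTerm A f) (hg : IsTerm A g) : IsTerm A fun v => f v * g v := by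
  simpa using IsTerm.of_ringTerm (.var 0 * .var 1 : Language.ring.Term (Fin 2))
    (A := A) (h := ![f, g]) (by simp [Fin.forall_fin_two, hf, hg])

theorem IsTerm.pow (hf : IsTerm A f) (n : ℕ) : IsTerm A fun v => f v ^ n := by
  induction n with
  | zero => simpa using IsTerm.one
  | succ n ih => simpa [pow_succ] using ih.mul hf

theorem IsTerm.comp {f : (β → K) → K} (hf : IsTerm A f) {h : β → (α → K) → K}
    (hh : ∀ i, IsTerm A (h i)) : IsTerm A fun v => f fun i => h i v := by
  obtain ⟨τ, hτ⟩ := hf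
  choose σ hσ using hh
  exact ⟨τ.subst σ, fun v => by simp [hσ, hτ]⟩

theorem definable_eq (hf : IsTerm A f) (hg : IsTerm A g) :
    A.Definable Language.ring {v | f v = g v} := by
  obtain ⟨τ, hτ⟩ := hf
  obtain ⟨σ, hσ⟩ := hg
  refine ⟨τ.equal σ, Set.ext fun v => ?_⟩
  change f v = g v ↔ (τ.equal σ).Realize v
  rw [Language.Formula.realize_equal, hτ, hσ]

theorem definable_preimage {S : Set (β → K)} (hS : A.Definable Language.ring S)
    {h : β → (α → K) → K} (hh : ∀ i, IsTerm A (h i)) :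
    A.Definable Language.ring {v | (fun i => h i v) ∈ S} := by
  obtain ⟨φ, rfl⟩ := hS
  choose σ hσ using hh
  refine ⟨φ.subst σ, Set.ext fun v => ?_⟩
  change φ.Realize (fun i => h i v) ↔ Language.Formula.Realize (φ.subst σ) v
  simp only [Language.Formula.Realize, Language.BoundedFormula.realize_subst, hσ]

theorem definable_mem {S : Set K} (hS : A.Definable₁ Language.ring S) (hf : IsTerm A f) :
    A.Definable Language.ring {v | f v ∈ S} :=
  definable_preimage hS fun _ => hf

theorem definable_rel {G : K → K → Prop} (hG : A.Definable Language.ring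
    {v : Fin 2 → K | G (v 0) (v 1)}) (hf : IsTerm A f) (hg : IsTerm A g) :
    A.Definable Language.ring {v | G (f v) (g v)} :=
  definable_preimage hG (h := ![f, g]) (by simp [Fin.forall_fin_two, hf, hg])

theorem definable_exists [Finite β] {p : (α → K) → (β → K) → Prop}
    (hp : A.Definable Language.ring
      {w : α ⊕ β → K | p (fun i => w (.inl i)) (fun j => w (.inr j))}) :
    A.Definable Language.ring {v | ∃ u, p v u} := by
  exact hp.exists_of_finite

theorem definable₁_diff {S T : Set K} (hS : A.Definable₁ Language.ring S)
    (hT : A.Definable₁ Language.ring T) : A.Definable₁ Language.ring (S \ T) :=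
  Set.Definable.sdiff hS hT

theorem definable₁_union {S T : Set K} (hS : A.Definable₁ Language.ring S)
    (hT : A.Definable₁ Language.ring T) : A.Definable₁ Language.ring (S ∪ T) :=
  Set.Definable.union hS hT

theorem definable₁_image [Finite α] {D : Set (α → K)} (hD : A.Definable Language.ring D)
    (hf : IsTerm A f) : A.Definable₁ Language.ring (f '' D) := by
  refine definable_exists ?_
  exact (hD.preimage_comp Sum.inr).inter
    (definable_eq (hf.comp fun i => .var (Sum.inr i)) (.var (Sum.inl 0)))

variable (A) in
/-- There is a bijection between `S` and `T` whose graph is definable with parameters from `A`. -/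
def DefEquiv (S T : Set K) : Prop :=
  ∃ G : K → K → Prop, A.Definable Language.ring {v : Fin 2 → K | G (v 0) (v 1)} ∧
    (∀ a, a ∈ S ↔ ∃ b, G a b) ∧ (∀ b, b ∈ T ↔ ∃ a, G a b) ∧
    ∀ a b a' b', G a b → G a' b' → (a = a' ↔ b = b')

variable {S T U S' T' : Set K}

theorem DefEquiv.symm (h : DefEquiv A S T) : DefEquiv A T S := by
  obtain ⟨G, hG, hS, hT, hi⟩ := h
  refine ⟨fun a b => G b a, ?_, hT, hS, fun a b a' b' h h' => (hi _ _ _ _ h h').symm⟩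
  exact definable_rel hG (.var 1) (.var 0)

theorem DefEquiv.trans (h : DefEquiv A S T) (h' : DefEquiv A T U) : DefEquiv A S U := by
  obtain ⟨G, hG, hS, hT, hi⟩ := h
  obtain ⟨H, hH, hT', hU, hi'⟩ := h'
  refine ⟨fun a c => ∃ z : Fin 1 → K, G a (z 0) ∧ H (z 0) c, definable_exists ?_, ?_, ?_, ?_⟩
  · exact (definable_rel hG (.var (Sum.inl 0)) (.var (Sum.inr 0))).inter
      (definable_rel hH (.var (Sum.inr 0)) (.var (Sum.inl 1)))
  · intro a
    rw [hS]
    constructor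
    · rintro ⟨b, hb⟩
      obtain ⟨c, hc⟩ := (hT' b).1 ((hT b).2 ⟨a, hb⟩)
      exact ⟨c, fun _ => b, hb, hc⟩
    · rintro ⟨c, z, hz, -⟩
      exact ⟨_, hz⟩
  · intro c
    rw [hU]
    constructor
    · rintro ⟨b, hb⟩
      obtain ⟨a, ha⟩ := (hT b).1 ((hT' b).2 ⟨c, hb⟩)
      exact ⟨a, fun _ => b, ha, hb⟩
    · rintro ⟨a, z, -, hz⟩
      exact ⟨_, hz⟩
  · rintro a b a' b' ⟨z, hz, hw⟩ ⟨z', hz', hw'⟩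
    rw [hi _ _ _ _ hz hz', hi' _ _ _ _ hw hw']

theorem DefEquiv.union (h : DefEquiv A S T) (h' : DefEquiv A S' T') (hS : Disjoint S S')
    (hT : Disjoint T T') : DefEquiv A (S ∪ S') (T ∪ T') := by
  obtain ⟨G, hG, hGS, hGT, hi⟩ := h
  obtain ⟨H, hH, hHS, hHT, hi'⟩ := h'
  rw [Set.disjoint_left] at hS hT
  simp only [hGS, hHS, hGT, hHT] at hS hT
  refine ⟨fun a b => G a b ∨ H a b, Set.Definable.union hG hH, ?_, ?_, ?_⟩
  · intro a
    simp only [mem_union, hGS, hHS, exists_or]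
  · intro a
    simp only [mem_union, hGT, hHT, exists_or]
  · rintro a b a' b' (h | h) (h' | h')
    · exact hi _ _ _ _ h h'
    · refine iff_of_false ?_ ?_ <;> rintro rfl
      exacts [hS ⟨_, h⟩ ⟨_, h'⟩, hT ⟨_, h⟩ ⟨_, h'⟩]
    · refine iff_of_false ?_ ?_ <;> rintro rfl
      exacts [hS ⟨_, h'⟩ ⟨_, h⟩, hT ⟨_, h'⟩ ⟨_, h⟩]
    · exact hi' _ _ _ _ h h'

theorem DefEquiv.refl (hS : A.Definable₁ Language.ring S) : DefEquiv A S S := by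
  refine ⟨fun a b => a ∈ S ∧ a = b, ?_, by simp, by simp, ?_⟩
  · exact (definable_mem hS (.var 0)).inter (definable_eq (.var 0) (.var 1))
  · rintro a b a' b' ⟨-, h⟩ ⟨-, h'⟩
    rw [h, h']

theorem DefEquiv.of_image [Finite α] {D : Set (α → K)} (hD : A.Definable Language.ring D)
    (hf : IsTerm A f) (hg : IsTerm A g) (hfD : InjOn f D) (hgD : InjOn g D) :
    DefEquiv A (f '' D) (g '' D) := by
  refine ⟨fun a b => ∃ v, v ∈ D ∧ f v = a ∧ g v = b, definable_exists ?_, by simp [Set.image],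
    ?_, ?_⟩
  · exact (hD.preimage_comp Sum.inr).inter
      ((definable_eq (hf.comp fun i => .var (Sum.inr i)) (.var (Sum.inl 0))).inter
      (definable_eq (hg.comp fun i => .var (Sum.inr i)) (.var (Sum.inl 1))))
  · intro b
    constructor
    · rintro ⟨v, hv, rfl⟩
      exact ⟨_, v, hv, rfl, rfl⟩
    · rintro ⟨a, v, hv, -, rfl⟩
      exact ⟨v, hv, rfl⟩
  · rintro _ _ _ _ ⟨v, hv, rfl, rfl⟩ ⟨v', hv', rfl, rfl⟩
    rw [hfD.eq_iff hv hv', hgD.eq_iff hv hv']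

theorem DefEquiv.exists_bijOn (h : DefEquiv A S T) : ∃ f : K → K, BijOn f S T ∧
    A.Definable Language.ring {v : Fin 2 → K | v 0 ∈ S ∧ f (v 0) = v 1} := by
  obtain ⟨G, hG, hS, hT, hi⟩ := h
  have : ∀ a, ∃ b, a ∈ S → G a b := fun a => by
    by_cases ha : a ∈ S
    · exact ((hS a).1 ha).imp fun b hb _ => hb
    · exact ⟨0, fun h => (ha h).elim⟩
  choose f hf using this
  refine ⟨f, ⟨fun a ha => (hT _).2 ⟨a, hf a ha⟩,
    fun a ha b hb h => (hi _ _ _ _ (hf a ha) (hf b hb)).2 h, fun b hb => ?_⟩, ?_⟩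
  · obtain ⟨a, ha⟩ := (hT b).1 hb
    have haS := (hS a).2 ⟨b, ha⟩
    exact ⟨a, haS, (hi _ _ _ _ (hf a haS) ha).1 rfl⟩
  · convert hG using 1
    refine Set.ext fun v => ⟨?_, fun h => ?_⟩
    · rintro ⟨h, h'⟩
      change G (v 0) (v 1)
      exact h' ▸ hf _ h
    · have hv := (hS _).2 ⟨_, h⟩
      exact ⟨hv, (hi _ _ _ _ (hf _ hv) h).1 rfl⟩

end Definability

section Absorption

variable {K : Type*} [Field K] [CompatibleRing K] {A : Set K} {Y B B' C C' S T U : Set K}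

theorem DefEquiv.absorb_congr (hY : A.Definable₁ Language.ring Y) (h : DefEquiv A Y (Y ∪ B))
    (hB : DefEquiv A B B') (hYB : Disjoint Y B) (hYB' : Disjoint Y B') :
    DefEquiv A Y (Y ∪ B') :=
  h.trans ((DefEquiv.refl hY).union hB hYB hYB')

theorem DefEquiv.absorb_union (hC : A.Definable₁ Language.ring C) (hYB : DefEquiv A Y (Y ∪ B))
    (hYC : DefEquiv A Y (Y ∪ C)) (h : Disjoint Y C) (h' : Disjoint B C) :
    DefEquiv A Y (Y ∪ (B ∪ C)) := by
  rw [← union_assoc]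
  exact hYC.trans (hYB.union (.refl hC) h (h.union_left h'))

theorem DefEquiv.absorb_of_union (hB : A.Definable₁ Language.ring B)
    (hYBC : DefEquiv A Y (Y ∪ (B ∪ C))) (hYC : DefEquiv A Y (Y ∪ C)) (h : Disjoint Y B)
    (h' : Disjoint B C) : DefEquiv A Y (Y ∪ B) := by
  refine hYBC.trans ?_
  rw [union_comm B C, ← union_assoc]
  exact hYC.symm.union (.refl hB) (h.union_left h'.symm) h

theorem DefEquiv.absorb_of_double (hY : A.Definable₁ Language.ring Y)
    (hB : A.Definable₁ Language.ring B)
    (hC' : A.Definable₁ Language.ring C') (hYBC : DefEquiv A Y (Y ∪ (B ∪ C)))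
    (hC : DefEquiv A C (C ∪ C')) (hCC' : DefEquiv A C C') (h₁ : Disjoint Y (B ∪ C))
    (h₂ : Disjoint Y C') (h₃ : Disjoint B C) (h₄ : Disjoint B C') (h₅ : Disjoint C C') :
    DefEquiv A Y (Y ∪ C) := by
  rw [disjoint_union_right] at h₁
  have h : DefEquiv A (B ∪ C) (B ∪ C ∪ C') := by
    rw [union_assoc]
    exact (DefEquiv.refl hB).union hC h₃ (h₃.union_right h₄)
  have h' : DefEquiv A (Y ∪ (B ∪ C)) (Y ∪ (B ∪ C) ∪ C') := by
    rw [union_assoc]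
    exact (DefEquiv.refl hY).union h (h₁.1.union_right h₁.2)
      ((h₁.1.union_right h₁.2).union_right h₂)
  have h'' : DefEquiv A (Y ∪ (B ∪ C) ∪ C') (Y ∪ C') :=
    hYBC.symm.union (.refl hC') (h₂.union_left (h₄.union_left h₅)) h₂
  exact ((hYBC.trans h').trans h'').absorb_congr hY hCC'.symm h₂ h₁.2

theorem DefEquiv.of_image2 (hS : A.Definable₁ Language.ring S) (hT : A.Definable₁ Language.ring T)
    {f g : K → K → K} (hf : IsTerm A fun v : Fin 2 → K => f (v 0) (v 1))
    (hg : IsTerm A fun v : Fin 2 → K => g (v 0) (v 1))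
    (hfi : ∀ x ∈ S, ∀ y ∈ T, ∀ x' ∈ S, ∀ y' ∈ T, f x y = f x' y' → x = x' ∧ y = y')
    (hgi : ∀ x ∈ S, ∀ y ∈ T, ∀ x' ∈ S, ∀ y' ∈ T, g x y = g x' y' → x = x' ∧ y = y') :
    DefEquiv A (image2 f S T) (image2 g S T) := by
  have key (f : K → K → K) : image2 f S T =
      (fun v : Fin 2 → K => f (v 0) (v 1)) '' {v | v 0 ∈ S ∧ v 1 ∈ T} := by
    ext z
    constructor
    · rintro ⟨x, hx, y, hy, rfl⟩
      exact ⟨![x, y], ⟨hx, hy⟩, rfl⟩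
    · rintro ⟨v, ⟨hx, hy⟩, rfl⟩
      exact ⟨_, hx, _, hy, rfl⟩
  rw [key, key]
  refine .of_image ((definable_mem hS (.var 0)).inter (definable_mem hT (.var 1))) hf hg ?_ ?_
  · rintro v ⟨hx, hy⟩ w ⟨hx', hy'⟩ h
    simpa [funext_iff, Fin.forall_fin_two] using hfi _ hx _ hy _ hx' _ hy' h
  · rintro v ⟨hx, hy⟩ w ⟨hx', hy'⟩ h
    simpa [funext_iff, Fin.forall_fin_two] using hgi _ hx _ hy _ hx' _ hy' h

theorem definable₁_image2 (hS : A.Definable₁ Language.ring S) (hT : A.Definable₁ Language.ring T)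
    {f : K → K → K} (hf : IsTerm A fun v : Fin 2 → K => f (v 0) (v 1)) :
    A.Definable₁ Language.ring (image2 f S T) := by
  convert definable₁_image ((definable_mem hS (.var 0)).inter (definable_mem hT (.var 1))) hf
    using 1
  ext z
  constructor
  · rintro ⟨x, hx, y, hy, rfl⟩
    exact ⟨![x, y], ⟨hx, hy⟩, rfl⟩
  · rintro ⟨v, ⟨hx, hy⟩, rfl⟩
    exact ⟨_, hx, _, hy, rfl⟩

end Absorption

section Coding

variable {K : Type*} [Field K]

/-- The properties of the valuation ring `R`, its uniformizer `t`, its coefficient field `F` and the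
set `P` of its elements with leading coefficient `1`, together with a coding `c` of triples of
elements of `R`, that are used to construct a definable bijection between `R` and `R \ {0}`. -/
structure IsCodedRing (R : Subring K) (t : K) (F P : Set K) (c : K → K → K → K) : Prop where
  t_mem : t ∈ R
  t_ne_zero : t ≠ 0
  t_ne_one : t ≠ 1
  zero_mem_coeff : (0 : K) ∈ F
  coeff_subset : F ⊆ R
  exists_coeff : ∀ r ∈ R, ∃ a ∈ F, ∃ s ∈ R, a + t * s = r
  coeff_unique : ∀ a ∈ F, ∀ s ∈ R, ∀ a' ∈ F, ∀ s' ∈ R, a + t * s = a' + t * s' → a = a' ∧ s = s'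
  monic_subset : P ⊆ R
  monic_ne_zero : ∀ p ∈ P, p ≠ 0
  exists_leading : ∀ r ∈ R, r ≠ 0 → ∃ a ∈ F, a ≠ 0 ∧ ∃ p ∈ P, a * p = r
  leading_unique : ∀ a ∈ F, a ≠ 0 → ∀ p ∈ P, ∀ a' ∈ F, a' ≠ 0 → ∀ p' ∈ P,
    a * p = a' * p' → a = a' ∧ p = p'
  monic_iff : ∀ p, p ∈ P ↔ (∃ p' ∈ P, t * p' = p) ∨ ∃ s ∈ R, 1 + t * s = p
  t_mul_ne : ∀ r ∈ R, ∀ s ∈ R, t * r ≠ 1 + t * s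
  dvd_or : ∀ x ∈ R, ∀ y ∈ R, x ≠ 0 → y ≠ 0 →
    (∃ z ∈ R, x * z = y) ∨ ∃ z ∈ R, t * z * y = x
  code_mem : ∀ x ∈ R, ∀ y ∈ R, ∀ z ∈ R, c x y z ∈ R
  code_inj : ∀ {x y z x' y' z'}, c x y z = c x' y' z' → x = x' ∧ y = y' ∧ z = z'
  code_zero : c 0 0 0 = 0

variable [CompatibleRing K] {R : Subring K} {t : K} {F P : Set K} {c : K → K → K → K}

theorem IsCodedRing.defEquiv (h : IsCodedRing R t F P c)
    (hR : ({t} : Set K).Definable₁ Language.ring (R : Set K))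
    (hF : ({t} : Set K).Definable₁ Language.ring F) (hP : ({t} : Set K).Definable₁ Language.ring P)
    (hc : IsTerm {t} fun v : Fin 3 → K => c (v 0) (v 1) (v 2)) :
    DefEquiv {t} (R : Set K) (R \ {0}) := by
  have hc' {α : Type} {f g k : (α → K) → K} (hf : IsTerm {t} f) (hg : IsTerm {t} g)
      (hk : IsTerm {t} k) : IsTerm {t} fun v => c (f v) (g v) (k v) :=
    hc.comp (h := ![f, g, k]) (by simp [Fin.forall_fin_succ, hf, hg, hk])
  have t_term {α : Type} : IsTerm {t} fun _ : α → K => t := .const rfl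
  have hZ : ({t} : Set K).Definable₁ Language.ring {(0 : K)} := definable_eq (.var 0) .zero
  have hX : ({t} : Set K).Definable₁ Language.ring (R \ {0} : Set K) := definable₁_diff hR hZ
  have hF' : ({t} : Set K).Definable₁ Language.ring (F \ {0} : Set K) := definable₁_diff hF hZ
  have h0 := R.zero_mem
  have ht0 := h.t_ne_zero
  have ht1 := h.t_ne_one
  set X : Set K := R \ {0} with hXdef
  set Y : Set K := image2 (fun x y => c x y 1) R P with hYdef
  set X₁ : Set K := image2 (fun x y => c x y 0) X {0} with hX₁def
  set X₂ : Set K := image2 (fun x y => c x y 0) {0} X with hX₂def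
  set Q : Set K := image2 (fun x y => c x y 0) X X with hQdef
  set Q' : Set K := image2 (fun x y => c x y t) X X with hQ'def
  have dY : ({t} : Set K).Definable₁ Language.ring Y :=
    definable₁_image2 hR hP (hc' (.var 0) (.var 1) .one)
  have dX₁ : ({t} : Set K).Definable₁ Language.ring X₁ :=
    definable₁_image2 hX hZ (hc' (.var 0) (.var 1) .zero)
  have dX₂ : ({t} : Set K).Definable₁ Language.ring X₂ :=
    definable₁_image2 hZ hX (hc' (.var 0) (.var 1) .zero)
  have dQ : ({t} : Set K).Definable₁ Language.ring Q :=
    definable₁_image2 hX hX (hc' (.var 0) (.var 1) .zero)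
  have dQ' : ({t} : Set K).Definable₁ Language.ring Q' :=
    definable₁_image2 hX hX (hc' (.var 0) (.var 1) t_term)
  have disj_tag {S T S' T' : Set K} {s s' : K} (hs : s ≠ s') :
      Disjoint (image2 (fun x y => c x y s) S T) (image2 (fun x y => c x y s') S' T') := by
    rw [Set.disjoint_left]
    rintro _ ⟨x, -, y, -, rfl⟩ ⟨x', -, y', -, h'⟩
    exact hs (h.code_inj h').2.2.symm
  have YX₁ : Disjoint Y X₁ := disj_tag one_ne_zero
  have YX₂ : Disjoint Y X₂ := disj_tag one_ne_zero
  have YQ : Disjoint Y Q := disj_tag one_ne_zero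
  have YQ' : Disjoint Y Q' := disj_tag ht1.symm
  have X₂Q' : Disjoint X₂ Q' := disj_tag ht0.symm
  have QQ' : Disjoint Q Q' := disj_tag ht0.symm
  have X₁X₂ : Disjoint X₁ X₂ := by
    rw [Set.disjoint_left]
    rintro _ ⟨x, hx, y, rfl, rfl⟩ ⟨x', rfl, y', hy', h'⟩
    exact hx.2 (h.code_inj h').1.symm
  have X₁Q : Disjoint X₁ Q := by
    rw [Set.disjoint_left]
    rintro _ ⟨x, hx, y, rfl, rfl⟩ ⟨x', hx', y', hy', h'⟩
    exact hy'.2 (h.code_inj h').2.1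
  have X₂Q : Disjoint X₂ Q := by
    rw [Set.disjoint_left]
    rintro _ ⟨x, rfl, y, hy, rfl⟩ ⟨x', hx', y', hy', h'⟩
    exact hx'.2 (h.code_inj h').1
  have zero_code {x y s : K} (h' : c x y s = 0) : x = 0 ∧ y = 0 ∧ s = 0 :=
    h.code_inj (h'.trans h.code_zero.symm)
  have ZY : (0 : K) ∉ Y := by
    rintro ⟨x, -, y, -, h'⟩
    exact one_ne_zero (zero_code h').2.2
  have ZX₁ : (0 : K) ∉ X₁ := by
    rintro ⟨x, hx, y, -, h'⟩
    exact hx.2 (zero_code h').1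
  have ZX₂ : (0 : K) ∉ X₂ := by
    rintro ⟨x, -, y, hy, h'⟩
    exact hy.2 (zero_code h').2.1
  have ZQ : (0 : K) ∉ Q := by
    rintro ⟨x, hx, y, -, h'⟩
    exact hx.2 (zero_code h').1
  have X₁_equiv : DefEquiv {t} X₂ X₁ := by
    have h₁ : X₁ = image2 (fun x y => c y x 0) {0} X := image2_swap _ _ _
    rw [h₁]
    refine .of_image2 hZ hX (hc' (.var 0) (.var 1) .zero) (hc' (.var 1) (.var 0) .zero) ?_ ?_
    · intro x _ y _ x' _ y' _ h'
      exact ⟨(h.code_inj h').1, (h.code_inj h').2.1⟩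
    · intro x _ y _ x' _ y' _ h'
      exact ⟨(h.code_inj h').2.1, (h.code_inj h').1⟩
  have Q_equiv : DefEquiv {t} Q Q' := by
    refine .of_image2 hX hX (hc' (.var 0) (.var 1) .zero) (hc' (.var 0) (.var 1) t_term) ?_ ?_ <;>
    · intro x _ y _ x' _ y' _ h'
      exact ⟨(h.code_inj h').1, (h.code_inj h').2.1⟩
  have mulX {x y : K} (hx : x ∈ X) (hy : y ∈ X) : x * y ∈ X :=
    ⟨R.mul_mem hx.1 hy.1, mul_ne_zero hx.2 hy.2⟩
  have tX : t ∈ X := ⟨h.t_mem, ht0⟩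
  -- Comparing valuations splits the pairs of nonzero elements into two copies of themselves.
  have Q_double : DefEquiv {t} Q (Q ∪ Q') := by
    have hQ : Q = image2 (fun x y => c x (x * y) 0) X X ∪
        image2 (fun x y => c (t * x * y) y 0) X X := by
      ext z
      constructor
      · rintro ⟨x, hx, y, hy, rfl⟩
        obtain ⟨w, hw, rfl⟩ | ⟨w, hw, rfl⟩ := h.dvd_or x hx.1 y hy.1 hx.2 hy.2
        · exact .inl ⟨x, hx, w, ⟨hw, right_ne_zero_of_mul hy.2⟩, rfl⟩
        · exact .inr ⟨w, ⟨hw, right_ne_zero_of_mul (left_ne_zero_of_mul hx.2)⟩, y, hy, rfl⟩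
      · rintro (⟨x, hx, y, hy, rfl⟩ | ⟨x, hx, y, hy, rfl⟩)
        · exact ⟨x, hx, _, mulX hx hy, rfl⟩
        · exact ⟨_, mulX (mulX tX hx) hy, y, hy, rfl⟩
    nth_rw 1 [hQ]
    refine .union ?_ ?_ ?_ QQ'
    · refine .of_image2 hX hX (hc' (.var 0) (.mul (.var 0) (.var 1)) .zero)
        (hc' (.var 0) (.var 1) .zero) ?_ ?_
      · intro x hx y _ x' _ y' _ h'
        obtain ⟨rfl, h', -⟩ := h.code_inj h'
        exact ⟨rfl, mul_left_cancel₀ hx.2 h'⟩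
      · intro x _ y _ x' _ y' _ h'
        exact ⟨(h.code_inj h').1, (h.code_inj h').2.1⟩
    · refine .of_image2 hX hX (hc' (.mul (.mul t_term (.var 0)) (.var 1)) (.var 1) .zero)
        (hc' (.var 0) (.var 1) t_term) ?_ ?_
      · intro x _ y hy x' _ y' _ h'
        obtain ⟨h', rfl, -⟩ := h.code_inj h'
        exact ⟨mul_left_cancel₀ ht0 (mul_right_cancel₀ hy.2 h'), rfl⟩
      · intro x _ y _ x' _ y' _ h'
        exact ⟨(h.code_inj h').1, (h.code_inj h').2.1⟩
    · rw [Set.disjoint_left]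
      rintro _ ⟨x, hx, y, hy, rfl⟩ ⟨x', hx', y', hy', h'⟩
      obtain ⟨h₁, h₂, -⟩ := h.code_inj h'
      refine h.t_mul_ne _ (mulX hx' hy).1 0 h0 ?_
      have : y' * (t * (x' * y)) = y' * (1 + t * 0) := by
        conv_rhs => rw [h₂, ← h₁]
        ring
      exact mul_left_cancel₀ hy'.2 this
  -- Splitting off the constant coefficient of the first coordinate.
  have Y_coeff : DefEquiv {t} Y (Y ∪ (X₂ ∪ Q)) := by
    let D : Set (Fin 3 → K) := {v | v 0 ∈ F \ {0} ∧ v 1 ∈ R ∧ v 2 ∈ P}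
    have hD : ({t} : Set K).Definable Language.ring D :=
      (definable_mem hF' (.var 0)).inter
        ((definable_mem hR (.var 1)).inter (definable_mem hP (.var 2)))
    have hY : Y = image2 (fun x y => c (t * x) y 1) R P ∪
        (fun v : Fin 3 → K => c (v 0 + t * v 1) (v 2) 1) '' D := by
      ext z
      constructor
      · rintro ⟨x, hx, y, hy, rfl⟩
        obtain ⟨a, ha, s, hs, rfl⟩ := h.exists_coeff x hx
        by_cases ha0 : a = 0
        · exact .inl ⟨s, hs, y, hy, by simp [ha0]⟩
        · exact .inr ⟨![a, s, y], ⟨⟨ha, ha0⟩, hs, hy⟩, rfl⟩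
      · rintro (⟨x, hx, y, hy, rfl⟩ | ⟨v, ⟨hv, hv', hv''⟩, rfl⟩)
        · exact ⟨_, R.mul_mem h.t_mem hx, y, hy, rfl⟩
        · exact ⟨_, R.add_mem (h.coeff_subset hv.1) (R.mul_mem h.t_mem hv'), _, hv'', rfl⟩
    have hXQ : X₂ ∪ Q = (fun v : Fin 3 → K => c (v 1) (v 0 * v 2) 0) '' D := by
      rw [← image2_union_left, hXdef, union_sdiff_self, singleton_union,
        insert_eq_of_mem (by exact h0)]
      ext z
      constructor
      · rintro ⟨x, hx, y, hy, rfl⟩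
        obtain ⟨a, ha, ha0, p, hp, rfl⟩ := h.exists_leading y hy.1 hy.2
        exact ⟨![a, x, p], ⟨⟨ha, ha0⟩, hx, hp⟩, rfl⟩
      · rintro ⟨v, ⟨hv, hv', hv''⟩, rfl⟩
        exact ⟨_, hv', _, ⟨R.mul_mem (h.coeff_subset hv.1) (h.monic_subset hv''),
          mul_ne_zero hv.2 (h.monic_ne_zero _ hv'')⟩, rfl⟩
    nth_rw 1 [hY]
    refine .union ?_ ?_ ?_ (YX₂.union_right YQ)
    · refine .of_image2 hR hP (hc' (.mul t_term (.var 0)) (.var 1) .one)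
        (hc' (.var 0) (.var 1) .one) ?_ ?_
      · intro x _ y _ x' _ y' _ h'
        exact ⟨mul_left_cancel₀ ht0 (h.code_inj h').1, (h.code_inj h').2.1⟩
      · intro x _ y _ x' _ y' _ h'
        exact ⟨(h.code_inj h').1, (h.code_inj h').2.1⟩
    · rw [hXQ]
      refine .of_image hD (hc' (.add (.var 0) (.mul t_term (.var 1))) (.var 2) .one)
        (hc' (.var 1) (.mul (.var 0) (.var 2)) .zero) ?_ ?_
      · rintro v ⟨hv, hv', hv''⟩ w ⟨hw, hw', hw''⟩ h'
        obtain ⟨h₁, h₂, -⟩ := h.code_inj h'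
        obtain ⟨h₃, h₄⟩ := h.coeff_unique _ hv.1 _ hv' _ hw.1 _ hw' h₁
        simp [funext_iff, Fin.forall_fin_succ, h₂, h₃, h₄]
      · rintro v ⟨hv, hv', hv''⟩ w ⟨hw, hw', hw''⟩ h'
        obtain ⟨h₁, h₂, -⟩ := h.code_inj h'
        obtain ⟨h₃, h₄⟩ := h.leading_unique _ hv.1 hv.2 _ hv'' _ hw.1 hw.2 _ hw'' h₂
        simp [funext_iff, Fin.forall_fin_succ, h₁, h₃, h₄]
    · rw [Set.disjoint_left]
      rintro _ ⟨x, hx, y, hy, rfl⟩ ⟨v, ⟨hv, hv', hv''⟩, h'⟩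
      have := (h.code_inj h').1
      refine hv.2 (h.coeff_unique _ hv.1 _ hv' 0 h.zero_mem_coeff _ hx ?_).1
      rw [this, zero_add]
  -- Shifting the second coordinate.
  have Y_shift : DefEquiv {t} Y (Y ∪ ({0} ∪ (X₁ ∪ (X₂ ∪ Q)))) := by
    have hY : Y = image2 (fun x y => c x (t * y) 1) R P ∪
        image2 (fun x y => c x (1 + t * y) 1) R R := by
      ext z
      constructor
      · rintro ⟨x, hx, y, hy, rfl⟩
        obtain ⟨p, hp, rfl⟩ | ⟨s, hs, rfl⟩ := (h.monic_iff y).1 hy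
        · exact .inl ⟨x, hx, p, hp, rfl⟩
        · exact .inr ⟨x, hx, s, hs, rfl⟩
      · rintro (⟨x, hx, y, hy, rfl⟩ | ⟨x, hx, y, hy, rfl⟩)
        · exact ⟨x, hx, _, (h.monic_iff _).2 (.inl ⟨y, hy, rfl⟩), rfl⟩
        · exact ⟨x, hx, _, (h.monic_iff _).2 (.inr ⟨y, hy, rfl⟩), rfl⟩
    have hRR : {0} ∪ (X₁ ∪ (X₂ ∪ Q)) = image2 (fun x y => c x y 0) R R := by
      have hRX : (R : Set K) = {0} ∪ X := by
        rw [hXdef, union_sdiff_self, singleton_union, insert_eq_of_mem (by exact h0)]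
      rw [hRX, image2_union_left, image2_union_right, image2_union_right, image2_singleton,
        h.code_zero]
      simp only [← hX₁def, ← hX₂def, ← hQdef]
      ext z
      simp only [mem_union]
      tauto
    have key : DefEquiv {t} (image2 (fun x y => c x (t * y) 1) R P ∪
        image2 (fun x y => c x (1 + t * y) 1) R R) (Y ∪ image2 (fun x y => c x y 0) R R) := by
      refine .union ?_ ?_ ?_ (disj_tag one_ne_zero)
      · refine .of_image2 hR hP (hc' (.var 0) (.mul t_term (.var 1)) .one)
          (hc' (.var 0) (.var 1) .one) ?_ ?_
        · intro x _ y _ x' _ y' _ h'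
          exact ⟨(h.code_inj h').1, mul_left_cancel₀ ht0 (h.code_inj h').2.1⟩
        · intro x _ y _ x' _ y' _ h'
          exact ⟨(h.code_inj h').1, (h.code_inj h').2.1⟩
      · refine .of_image2 hR hR (hc' (.var 0) (.add .one (.mul t_term (.var 1))) .one)
          (hc' (.var 0) (.var 1) .zero) ?_ ?_
        · intro x _ y _ x' _ y' _ h'
          exact ⟨(h.code_inj h').1, mul_left_cancel₀ ht0 (add_left_cancel (h.code_inj h').2.1)⟩
        · intro x _ y _ x' _ y' _ h'
          exact ⟨(h.code_inj h').1, (h.code_inj h').2.1⟩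
      · rw [Set.disjoint_left]
        rintro _ ⟨x, hx, y, hy, rfl⟩ ⟨x', hx', y', hy', h'⟩
        exact h.t_mul_ne _ (h.monic_subset hy) _ hy' (h.code_inj h').2.1.symm
    rwa [← hY, ← hRR] at key
  have Y_Q : DefEquiv {t} Y (Y ∪ Q) :=
    Y_coeff.absorb_of_double dY dX₂ dQ' Q_double Q_equiv (YX₂.union_right YQ) YQ' X₂Q X₂Q' QQ'
  have Y_X₂ : DefEquiv {t} Y (Y ∪ X₂) := Y_coeff.absorb_of_union dX₂ Y_Q YX₂ X₂Q
  have Y_X₁ : DefEquiv {t} Y (Y ∪ X₁) := Y_X₂.absorb_congr dY X₁_equiv YX₂ YX₁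
  have Y_all : DefEquiv {t} Y (Y ∪ (X₁ ∪ (X₂ ∪ Q))) :=
    Y_X₁.absorb_union (definable₁_union dX₂ dQ) Y_coeff (YX₂.union_right YQ)
      (X₁X₂.union_right X₁Q)
  have Y_zero : DefEquiv {t} Y (Y ∪ {0}) :=
    Y_shift.absorb_of_union hZ Y_all (disjoint_singleton_right.2 ZY)
      (disjoint_singleton_left.2 (by simp [ZX₁, ZX₂, ZQ]))
  have hYR : Y ∪ {0} ⊆ R := by
    rintro _ (⟨x, hx, y, hy, rfl⟩ | rfl)
    · exact h.code_mem _ hx _ (h.monic_subset hy) _ R.one_mem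
    · exact h0
  have h₁ : (R : Set K) = Y ∪ {0} ∪ (R \ (Y ∪ {0})) := (union_sdiff_cancel hYR).symm
  have h₂ : X = Y ∪ (R \ (Y ∪ {0})) := by
    rw [hXdef]
    nth_rw 1 [h₁]
    rw [union_sdiff_distrib, sdiff_sdiff, union_assoc, union_self, union_sdiff_right,
      sdiff_singleton_eq_self ZY]
  rw [h₂]
  nth_rw 1 [h₁]
  exact Y_zero.symm.union (.refl (definable₁_diff hR (definable₁_union dY hZ)))
    disjoint_sdiff_right (disjoint_sdiff_right.mono_left subset_union_left)

end Coding

section Laurent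

open HahnSeries

variable {F : Type*} [Field F]

theorem mem_integers {x : LaurentSeries F} : x ∈ (ofPowerSeries ℤ F).range ↔ 0 ≤ x.order := by
  constructor
  · rintro ⟨f, rfl⟩
    rw [← zero_le_orderTop_iff, ← WithTop.coe_zero, le_orderTop_iff_forall]
    intro j hj
    have hj : j < 0 := by exact_mod_cast hj
    rw [PowerSeries.coeff_coe, if_pos hj]
  · intro hx
    obtain ⟨n, hn⟩ := Int.eq_ofNat_of_zero_le hx
    exact ⟨_, LaurentSeries.X_order_mul_powerSeriesPart hn.symm⟩

theorem C_mem_integers (a : F) : C a ∈ (ofPowerSeries ℤ F).range :=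
  ⟨PowerSeries.C a, ofPowerSeries_C a⟩

theorem single_one_mem_integers : single (1 : ℤ) (1 : F) ∈ (ofPowerSeries ℤ F).range :=
  ⟨PowerSeries.X, ofPowerSeries_X⟩

theorem single_one_ne_zero : single (1 : ℤ) (1 : F) ≠ 0 := single_ne_zero one_ne_zero

theorem order_single_one_mul {x : LaurentSeries F} (hx : x ≠ 0) :
    (single (1 : ℤ) (1 : F) * x).order = 1 + x.order := by
  rw [order_mul single_one_ne_zero hx, order_single one_ne_zero]

theorem mem_integers_of_order_le {x z : LaurentSeries F} (hx : x ≠ 0)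
    (h : x.order ≤ (x * z).order) : z ∈ (ofPowerSeries ℤ F).range := by
  rcases eq_or_ne z 0 with rfl | hz
  · exact zero_mem _
  · rw [order_mul hx hz] at h
    exact mem_integers.2 (by lia)

theorem exists_C_add_single_mul {x : LaurentSeries F} (hx : x ∈ (ofPowerSeries ℤ F).range) :
    ∃ a, ∃ s ∈ (ofPowerSeries ℤ F).range, C a + single (1 : ℤ) (1 : F) * s = x := by
  obtain ⟨f, rfl⟩ := hx
  refine ⟨PowerSeries.constantCoeff f, _,
    ⟨.mk fun n => PowerSeries.coeff (n + 1) f, rfl⟩, ?_⟩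
  conv_rhs => rw [PowerSeries.eq_X_mul_shift_add_const f]
  rw [map_add, map_mul, ofPowerSeries_X, ofPowerSeries_C, add_comm]

theorem C_add_single_mul_inj {a b : F} {r s : LaurentSeries F}
    (hr : r ∈ (ofPowerSeries ℤ F).range) (hs : s ∈ (ofPowerSeries ℤ F).range)
    (h : C a + single (1 : ℤ) (1 : F) * r = C b + single 1 1 * s) : a = b ∧ r = s := by
  obtain ⟨f, rfl⟩ := hr
  obtain ⟨g, rfl⟩ := hs
  simp only [← ofPowerSeries_C (Γ := ℤ), ← ofPowerSeries_X (Γ := ℤ), ← map_mul, ← map_add] at h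
  have hab : a = b := by
    simpa using congrArg PowerSeries.constantCoeff (ofPowerSeries_injective h)
  refine ⟨hab, ?_⟩
  rw [hab] at h
  rw [mul_left_cancel₀ PowerSeries.X_ne_zero (add_left_cancel (ofPowerSeries_injective h))]

theorem leadingCoeff_C_add {a : F} (ha : a ≠ 0) {s : LaurentSeries F}
    (hs : s ∈ (ofPowerSeries ℤ F).range) :
    (C a + single (1 : ℤ) (1 : F) * s).leadingCoeff = a := by
  rw [leadingCoeff_add_eq_left, C_apply, leadingCoeff_of_single]
  rw [C_apply, orderTop_single ha, orderTop_mul, orderTop_single one_ne_zero]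
  refine lt_of_lt_of_le ?_ (add_le_add_right (zero_le_orderTop_iff.2 (mem_integers.1 hs)) _)
  exact_mod_cast zero_lt_one

variable (F) in
/-- The elements of `F⟦t⟧` with leading coefficient `1`. -/
def monicIntegers : Set (LaurentSeries F) :=
  {x | x ∈ (ofPowerSeries ℤ F).range ∧ x.leadingCoeff = 1}

theorem mem_monicIntegers_iff (p : LaurentSeries F) : p ∈ monicIntegers F ↔
    (∃ p' ∈ monicIntegers F, single 1 1 * p' = p) ∨
      ∃ s ∈ (ofPowerSeries ℤ F).range, 1 + single 1 1 * s = p := by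
  constructor
  · rintro ⟨hp, h⟩
    obtain ⟨a, s, hs, rfl⟩ := exists_C_add_single_mul hp
    rcases eq_or_ne a 0 with rfl | ha
    · rw [C_zero, zero_add, leadingCoeff_mul, leadingCoeff_of_single, one_mul] at h
      exact .inl ⟨s, ⟨hs, h⟩, by rw [C_zero, zero_add]⟩
    · rw [leadingCoeff_C_add ha hs] at h
      exact .inr ⟨s, hs, by rw [h, C_one]⟩
  · rintro (⟨p, ⟨hp, h⟩, rfl⟩ | ⟨s, hs, rfl⟩)
    · exact ⟨mul_mem single_one_mem_integers hp, by
        rw [leadingCoeff_mul, leadingCoeff_of_single, h, one_mul]⟩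
    · rw [← C_one]
      exact ⟨add_mem (C_mem_integers 1) (mul_mem single_one_mem_integers hs),
        leadingCoeff_C_add one_ne_zero hs⟩

theorem leadingCoeff_C_mul {a : F} {p : LaurentSeries F} (hp : p ∈ monicIntegers F) :
    (C a * p).leadingCoeff = a := by
  rw [leadingCoeff_mul, C_apply, leadingCoeff_of_single, hp.2, mul_one]

theorem monicIntegers_ne_zero {p : LaurentSeries F} (hp : p ∈ monicIntegers F) : p ≠ 0 :=
  leadingCoeff_ne_zero.1 (by rw [hp.2]; exact one_ne_zero)

variable [Fintype F]

theorem add_pow_card {A : Type*} [CommRing A] [Algebra F A] (x y : A) :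
    (x + y) ^ Fintype.card F = x ^ Fintype.card F + y ^ Fintype.card F :=
  map_add (FiniteField.frobeniusAlgHom F A) x y

theorem sub_pow_card {A : Type*} [CommRing A] [Algebra F A] (x y : A) :
    (x - y) ^ Fintype.card F = x ^ Fintype.card F - y ^ Fintype.card F :=
  map_sub (FiniteField.frobeniusAlgHom F A) x y

theorem sum_pow_card {A ι : Type*} [CommRing A] [Algebra F A] (s : Finset ι) (f : ι → A) :
    (∑ i ∈ s, f i) ^ Fintype.card F = ∑ i ∈ s, f i ^ Fintype.card F :=
  map_sum (FiniteField.frobeniusAlgHom F A) f s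

open PowerSeries in
theorem exists_pow_card_eq_add {g : PowerSeries F} (hg : X ∣ g) :
    ∃ y : PowerSeries F, y ^ Fintype.card F = y + g := by
  have hq : 1 < Fintype.card F := Fintype.one_lt_card
  set q := Fintype.card F with hq_def
  let S : ℕ → PowerSeries F := fun N => ∑ n ∈ Finset.range N, g ^ q ^ n
  have hdvd (N : ℕ) : X ^ N ∣ g ^ q ^ N :=
    (pow_dvd_pow X (Nat.lt_pow_self hq).le).trans (pow_dvd_pow_of_dvd hg _)
  have hsucc (N : ℕ) : S (N + 1) = S N + g ^ q ^ N := Finset.sum_range_succ _ _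
  have hpow (N : ℕ) : S N ^ q = S (N + 1) - g := by
    rw [sum_pow_card]
    simp only [S, Finset.sum_range_succ', ← pow_mul, pow_succ, ← hq_def]
    simp
  have hstable {m N : ℕ} (h : m + 1 ≤ N) : coeff m (S N) = coeff m (S (m + 1)) := by
    induction N, h using Nat.le_induction with
    | base => rfl
    | succ N hN ih => rw [hsucc, map_add, ih, X_pow_dvd_iff.1 (hdvd N) m hN, add_zero]
  let y : PowerSeries F := mk fun m => -coeff m (S (m + 1))
  have hy (N : ℕ) : X ^ N ∣ y + S N := by
    refine X_pow_dvd_iff.2 fun m hm => ?_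
    rw [map_add, coeff_mk, hstable hm, neg_add_cancel]
  refine ⟨y, sub_eq_zero.1 (PowerSeries.ext fun m => ?_)⟩
  refine X_pow_dvd_iff.1 (?_ : X ^ (m + 1) ∣ _) m m.lt_succ_self
  have h := (hy (m + 1)).trans (dvd_pow_self _ (by lia : q ≠ 0))
  rw [add_pow_card, hpow, hsucc] at h
  have := (h.sub (hdvd (m + 1))).sub (hy (m + 1))
  ring_nf at this ⊢
  exact this

theorem mem_integers_iff_exists {x : LaurentSeries F} : x ∈ (ofPowerSeries ℤ F).range ↔
    ∃ y, y ^ Fintype.card F = y + single 1 1 * x ^ Fintype.card F := by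
  have hq : 1 < Fintype.card F := Fintype.one_lt_card
  constructor
  · rintro ⟨f, rfl⟩
    obtain ⟨y, hy⟩ := exists_pow_card_eq_add
      (dvd_mul_right PowerSeries.X (f ^ Fintype.card F))
    refine ⟨ofPowerSeries ℤ F y, ?_⟩
    rw [← map_pow, hy, map_add, map_mul, map_pow, ofPowerSeries_X]
  · rintro ⟨y, hy⟩
    rw [mem_integers]
    by_contra! hx
    have hx0 : x ≠ 0 := by rintro rfl; simp at hx
    have hxy : y ^ Fintype.card F - y = single 1 1 * x ^ Fintype.card F := by rw [hy]; ring
    have hord := order_single_one_mul (pow_ne_zero (Fintype.card F) hx0)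
    rw [order_pow, nsmul_eq_mul] at hord
    have hne := mul_ne_zero (single_one_ne_zero (F := F)) (pow_ne_zero (Fintype.card F) hx0)
    have hneg : 1 + (Fintype.card F : ℤ) * x.order < 0 := by nlinarith
    have hy0 : y.order < 0 := by
      by_contra! h
      have h' := mem_integers.2 h
      have := mem_integers.1 (hxy ▸ sub_mem (pow_mem h' (Fintype.card F)) h')
      lia
    have hyne : y ≠ 0 := by rintro rfl; simp at hy0
    have hlt : (y ^ Fintype.card F).orderTop < y.orderTop := by
      rw [← order_eq_orderTop_of_ne_zero hyne,
        ← order_eq_orderTop_of_ne_zero (pow_ne_zero _ hyne), order_pow, nsmul_eq_mul]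
      have : (Fintype.card F : ℤ) * y.order < y.order := by nlinarith
      exact_mod_cast this
    have := orderTop_sub hlt
    rw [hxy, ← order_eq_orderTop_of_ne_zero hne,
      ← order_eq_orderTop_of_ne_zero (pow_ne_zero _ hyne), hord, order_pow, nsmul_eq_mul] at this
    have h1 : 1 + (Fintype.card F : ℤ) * x.order = Fintype.card F * y.order := by
      exact_mod_cast this
    have h2 : (Fintype.card F : ℤ) ∣ 1 := ⟨y.order - x.order, by linarith⟩
    have := Int.le_of_dvd one_pos h2
    lia

theorem C_pow_card (a : F) : (C a : LaurentSeries F) ^ Fintype.card F = C a := by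
  rw [← map_pow, FiniteField.pow_card]

theorem order_eq_zero_of_pow_card_eq {x : LaurentSeries F} (h : x ^ Fintype.card F = x) :
    x.order = 0 := by
  have hq : 1 < Fintype.card F := Fintype.one_lt_card
  have := congrArg order h
  rw [order_pow, nsmul_eq_mul] at this
  have : ((Fintype.card F : ℤ) - 1) * x.order = 0 := by linarith
  rcases mul_eq_zero.1 this with h | h
  · lia
  · exact h

theorem mem_range_C_iff {x : LaurentSeries F} : x ∈ range C ↔ x ^ Fintype.card F = x := by
  constructor
  · rintro ⟨a, rfl⟩
    exact C_pow_card a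
  · intro h
    obtain ⟨a, s, hs, rfl⟩ := exists_C_add_single_mul
      (mem_integers.2 (order_eq_zero_of_pow_card_eq h).ge)
    rw [add_pow_card, C_pow_card, add_right_inj] at h
    have hs0 : s = 0 := by
      by_contra hs0
      have := order_eq_zero_of_pow_card_eq h
      rw [order_single_one_mul hs0] at this
      have := mem_integers.1 hs
      lia
    exact ⟨a, by simp [hs0]⟩

theorem pow_card_add_inj {x y x' y' : LaurentSeries F}
    (h : x ^ Fintype.card F + single 1 1 * y ^ Fintype.card F =
      x' ^ Fintype.card F + single 1 1 * y' ^ Fintype.card F) : x = x' ∧ y = y' := by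
  have hq : 1 < Fintype.card F := Fintype.one_lt_card
  have key : (x - x') ^ Fintype.card F = single 1 1 * (y' - y) ^ Fintype.card F := by
    rw [sub_pow_card, sub_pow_card]
    linear_combination h
  have hy : y' - y = 0 := by
    by_contra hy
    have := congrArg order key
    rw [order_single_one_mul (pow_ne_zero _ hy), order_pow, order_pow, nsmul_eq_mul,
      nsmul_eq_mul] at this
    have h2 : (Fintype.card F : ℤ) ∣ 1 :=
      ⟨(x - x').order - (y' - y).order, by linarith⟩
    have := Int.le_of_dvd one_pos h2
    lia
  rw [hy, zero_pow (by lia), mul_zero] at key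
  exact ⟨sub_eq_zero.1 (eq_zero_of_pow_eq_zero key), (sub_eq_zero.1 hy).symm⟩

theorem mem_monicIntegers_iff_exists {x : LaurentSeries F} : x ∈ monicIntegers F ↔
    x ∈ (ofPowerSeries ℤ F).range ∧ ∃ i : Fin (Fintype.card F - 1), ∃ w : Fin 2 → LaurentSeries F,
      (w 0 ≠ 0 ∧ w 1 ∈ (ofPowerSeries ℤ F).range) ∧
        x = single 1 1 ^ (i : ℕ) * w 0 ^ (Fintype.card F - 1) * (1 + single 1 1 * w 1) := by
  have hq : 1 < Fintype.card F := Fintype.one_lt_card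
  have hq' : ((Fintype.card F - 1 : ℕ) : ℤ) ≠ 0 := by lia
  refine and_congr_right fun hx => ⟨fun h => ?_, ?_⟩
  · have hx0 : x ≠ 0 := monicIntegers_ne_zero ⟨hx, h⟩
    have hmod := Int.emod_nonneg x.order hq'
    have hlt := Int.emod_lt_of_pos x.order (by lia : (0 : ℤ) < (Fintype.card F - 1 : ℕ))
    have hdiv := Int.emod_add_mul_ediv x.order (Fintype.card F - 1 : ℕ)
    set u : LaurentSeries F := single 1 1 ^ (x.order % (Fintype.card F - 1 : ℕ)).toNat *
      single (x.order / (Fintype.card F - 1 : ℕ)) 1 ^ (Fintype.card F - 1) with hu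
    have hu' : u = single x.order 1 := by
      rw [hu, single_pow, single_pow, single_mul_single, one_pow, one_pow, one_mul]
      congr 2
      simp only [nsmul_eq_mul, Int.toNat_of_nonneg hmod, mul_one]
      exact hdiv
    have hu0 : u ≠ 0 := hu' ▸ single_ne_zero one_ne_zero
    have hux := mul_div_cancel₀ x hu0
    have hmem : x / u ∈ (ofPowerSeries ℤ F).range := by
      refine mem_integers_of_order_le hu0 ?_
      rw [hux, hu', order_single one_ne_zero]
    obtain ⟨a, s, hs, hxs⟩ := exists_C_add_single_mul hmem
    have hxu0 : x / u ≠ 0 := div_ne_zero hx0 hu0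
    have ha : a ≠ 0 := by
      rintro rfl
      rw [C_zero, zero_add] at hxs
      have hs0 : s ≠ 0 := by rintro rfl; exact hxu0 (by rw [← hxs, mul_zero])
      have h1 := order_mul hu0 hxu0
      have h2 := mem_integers.1 hs
      rw [hux, hu', order_single one_ne_zero, ← hu', ← hxs, order_single_one_mul hs0] at h1
      lia
    have ha1 : a = 1 := by
      have := leadingCoeff_C_add ha hs
      rw [hxs] at this
      have h3 := congrArg leadingCoeff hux
      rwa [leadingCoeff_mul, this, hu', leadingCoeff_of_single, one_mul, h] at h3
    refine ⟨⟨_, (by lia : (x.order % (Fintype.card F - 1 : ℕ)).toNat < _)⟩,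
      ![single (x.order / (Fintype.card F - 1 : ℕ)) 1, s],
      ⟨single_ne_zero one_ne_zero, hs⟩, ?_⟩
    rw [ha1, C_one] at hxs
    simp only [Matrix.cons_val_zero, Matrix.cons_val_one]
    rw [← hu, hxs, hux]
  · rintro ⟨i, w, ⟨hw0, hw1⟩, rfl⟩
    rw [leadingCoeff_mul, ← C_one, leadingCoeff_C_add one_ne_zero hw1, leadingCoeff_mul, single_pow,
      leadingCoeff_of_single, one_pow, one_mul, mul_one]
    have (n : ℕ) : (w 0 ^ n).leadingCoeff = (w 0).leadingCoeff ^ n := by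
      induction n with
      | zero => simp
      | succ n ih => rw [pow_succ, leadingCoeff_mul, ih, pow_succ]
    rw [this, FiniteField.pow_card_sub_one_eq_one _ (leadingCoeff_ne_zero.2 hw0)]

theorem isCodedRing : IsCodedRing (ofPowerSeries ℤ F).range (single (1 : ℤ) (1 : F))
    (range C) (monicIntegers F) fun x y z =>
      (x ^ Fintype.card F + single 1 1 * y ^ Fintype.card F) ^ Fintype.card F +
        single 1 1 * z ^ Fintype.card F where
  t_mem := single_one_mem_integers
  t_ne_zero := single_one_ne_zero
  t_ne_one h := by simpa [order_single] using congrArg order h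
  zero_mem_coeff := ⟨0, C_zero⟩
  coeff_subset := by rintro _ ⟨a, rfl⟩; exact C_mem_integers a
  exists_coeff r hr := by
    obtain ⟨a, s, hs, h⟩ := exists_C_add_single_mul hr
    exact ⟨_, ⟨a, rfl⟩, s, hs, h⟩
  coeff_unique := by
    rintro _ ⟨a, rfl⟩ s hs _ ⟨b, rfl⟩ r hr h
    obtain ⟨rfl, rfl⟩ := C_add_single_mul_inj hs hr h
    exact ⟨rfl, rfl⟩
  monic_subset _ hp := hp.1
  monic_ne_zero _ hp := monicIntegers_ne_zero hp
  exists_leading r hr hr0 := by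
    have hlc := leadingCoeff_ne_zero.2 hr0
    refine ⟨_, ⟨r.leadingCoeff, rfl⟩, C_ne_zero hlc, C r.leadingCoeff⁻¹ * r,
      ⟨mul_mem (C_mem_integers _) hr, ?_⟩, ?_⟩
    · rw [leadingCoeff_mul, C_apply, leadingCoeff_of_single, inv_mul_cancel₀ hlc]
    · rw [← mul_assoc, ← map_mul, mul_inv_cancel₀ hlc, C_one, one_mul]
  leading_unique := by
    rintro _ ⟨a, rfl⟩ ha p hp _ ⟨b, rfl⟩ - p' hp' h
    have hab := congrArg leadingCoeff h
    rw [leadingCoeff_C_mul hp, leadingCoeff_C_mul hp'] at hab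
    subst hab
    exact ⟨rfl, mul_left_cancel₀ ha h⟩
  monic_iff := mem_monicIntegers_iff
  t_mul_ne r hr s hs h := by
    rw [← zero_add (_ * r), ← C_zero, ← C_one] at h
    exact zero_ne_one (C_add_single_mul_inj hr hs h).1
  dvd_or x hx y hy hx0 hy0 := by
    rcases le_or_gt x.order y.order with h | h
    · have hxy : x * (y / x) = y := mul_div_cancel₀ y hx0
      exact .inl ⟨y / x, mem_integers_of_order_le hx0 (by rwa [hxy]), hxy⟩
    · have h0 := mul_ne_zero single_one_ne_zero hy0
      have hxy := mul_div_cancel₀ x h0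
      refine .inr ⟨_, mem_integers_of_order_le h0 ?_, by rw [mul_right_comm]; exact hxy⟩
      rw [hxy, order_single_one_mul hy0]
      lia
  code_mem x hx y hy z hz := by
    have ht := single_one_mem_integers (F := F)
    exact add_mem (pow_mem (add_mem (pow_mem hx _) (mul_mem ht (pow_mem hy _))) _)
      (mul_mem ht (pow_mem hz _))
  code_inj h := by
    obtain ⟨h1, h2⟩ := pow_card_add_inj h
    obtain ⟨h3, h4⟩ := pow_card_add_inj h1
    exact ⟨h3, h4, h2⟩
  code_zero := by simp

theorem definable₁_integers : ({single (1 : ℤ) (1 : F)} : Set (LaurentSeries F)).Definable₁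
    Language.ring ((ofPowerSeries ℤ F).range : Set (LaurentSeries F)) := by
  have h := definable_exists (A := {single (1 : ℤ) (1 : F)}) (α := Fin 1) (β := Fin 1)
    (p := fun v w => w 0 ^ Fintype.card F = w 0 + single 1 1 * v 0 ^ Fintype.card F)
    (definable_eq (.pow (.var _) _)
      (.add (.var _) (.mul (.const (mem_singleton _)) (.pow (.var _) _))))
  rw [Definable₁]
  refine (congrArg _ (Set.ext fun v => ?_)).mp h
  refine Iff.trans ?_ (mem_integers_iff_exists (x := v 0)).symm
  exact ⟨fun ⟨w, hw⟩ => ⟨w 0, hw⟩, fun ⟨y, hy⟩ => ⟨fun _ => y, hy⟩⟩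

theorem definable₁_range_C : ({single (1 : ℤ) (1 : F)} : Set (LaurentSeries F)).Definable₁
    Language.ring (range C : Set (LaurentSeries F)) := by
  rw [show (range C : Set (LaurentSeries F)) = {x | x ^ Fintype.card F = x} from
    Set.ext fun _ => mem_range_C_iff]
  exact definable_eq (.pow (.var 0) _) (.var 0)

theorem definable₁_monicIntegers : ({single (1 : ℤ) (1 : F)} : Set (LaurentSeries F)).Definable₁
    Language.ring (monicIntegers F) := by
  have ht {α : Type} : IsTerm {single (1 : ℤ) (1 : F)}
    fun _ : α → LaurentSeries F => single (1 : ℤ) (1 : F) := .const (mem_singleton _)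
  have h (i : Fin (Fintype.card F - 1)) :=
    definable_exists (A := {single (1 : ℤ) (1 : F)}) (α := Fin 1) (β := Fin 2)
    (p := fun v w => (w 0 ≠ 0 ∧ w 1 ∈ (ofPowerSeries ℤ F).range) ∧
        v 0 = single 1 1 ^ (i : ℕ) * w 0 ^ (Fintype.card F - 1) * (1 + single 1 1 * w 1))
    (((definable_eq (.var _) .zero).compl.inter (definable_mem definable₁_integers (.var _))).inter
      (definable_eq (.var _) (.mul (.mul (.pow ht _) (.pow (.var _) _))
        (.add .one (.mul ht (.var _))))))
  rw [Definable₁]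
  refine (congrArg _ (Set.ext fun v => ?_)).mp
    (definable₁_integers.inter (Set.definable_iUnion_of_finite h))
  refine Iff.trans ?_ (mem_monicIntegers_iff_exists (x := v 0)).symm
  exact and_congr_right fun _ => mem_iUnion

theorem isTerm_code : IsTerm {single (1 : ℤ) (1 : F)} fun v : Fin 3 → LaurentSeries F =>
    (v 0 ^ Fintype.card F + single 1 1 * v 1 ^ Fintype.card F) ^ Fintype.card F +
      single 1 1 * v 2 ^ Fintype.card F :=
  .add (.pow (.add (.pow (.var 0) _) (.mul (.const (mem_singleton _)) (.pow (.var 1) _))) _)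
    (.mul (.const (mem_singleton _)) (.pow (.var 2) _))

end Laurent

end DefinableLaurent

theorem exists_definable_bij_R_minus_point_laurent (F : Type*) [Field F] [Fintype F] :
    ∃ f : LaurentSeries F → LaurentSeries F,
      Set.BijOn f (Set.range (HahnSeries.ofPowerSeries ℤ F))
        (Set.range (HahnSeries.ofPowerSeries ℤ F) \ {0}) ∧
      Set.Definable ({HahnSeries.single (1 : ℤ) (1 : F)} : Set (LaurentSeries F))
        Language.ring
        {v : Fin 2 → LaurentSeries F |
          v 0 ∈ Set.range (HahnSeries.ofPowerSeries ℤ F) ∧ f (v 0) = v 1} :=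
  (DefinableLaurent.isCodedRing.defEquiv DefinableLaurent.definable₁_integers
    DefinableLaurent.definable₁_range_C DefinableLaurent.definable₁_monicIntegers
    DefinableLaurent.isTerm_code).exists_bijOn
end
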